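/- arXiv:2605.09316 — 10 statements merged into one kernel-verified Lean document; each statement's English description precedes it below -/
import Mathlib

section
/- Let a₀,…,a_{N−1} be independent uniformly distributed {0,1}-valued random variables, let b be a uniformly distributed random variable on {0,…,N−1} independent of them, and let β be any {0,1}-valued random variable on the same probability space. With P_K := Pr[β = a_K | b = K], the information score satisfies Σ_{K=0}^{N−1} I(a_K : β | b = K) ≥ N − Σ_{K=0}^{N−1} h(P_K). -/
open MeasureTheory ProbabilityTheory
open scoped ENNReal

/-- Binary entropy in bits: `h(p) = -p log₂ p - (1-p) log₂ (1-p)`, with the convention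
`0 · log₂ 0 = 0` (automatic since `Real.logb 2 0 = 0`). -/
noncomputable def binEnt (p : ℝ) : ℝ :=
  -(p * Real.logb 2 p) - (1 - p) * Real.logb 2 (1 - p)

/-- Shannon entropy (in bits) of a finitely-valued random variable. -/
noncomputable def entropy {Ω : Type*} [MeasurableSpace Ω] {S : Type*} [Fintype S]
    (μ : Measure Ω) (X : Ω → S) : ℝ :=
  -∑ s : S, ((μ (X ⁻¹' {s})).toReal * Real.logb 2 (μ (X ⁻¹' {s})).toReal)

/-- Shannon mutual information (in bits) between two finitely-valued random variables:
`I(X:Y) = H(X) + H(Y) - H(X,Y)`. -/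
noncomputable def mutualInfo {Ω : Type*} [MeasurableSpace Ω] {S T : Type*} [Fintype S] [Fintype T]
    (μ : Measure Ω) (X : Ω → S) (Y : Ω → T) : ℝ :=
  entropy μ X + entropy μ Y - entropy μ (fun ω => (X ω, Y ω))


lemma gibbs_cell (p r c : ℝ) (hp : 0 ≤ p) (hr : p ≤ r) (hc : p ≤ c) :
    p - r * c ≤ p * Real.log p - p * Real.log r - p * Real.log c := by
  rcases hp.eq_or_lt with h | h
  · subst h
    have := mul_nonneg hr hc
    simp; exact this
  · have hr0 : 0 < r := lt_of_lt_of_le h hr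
    have hc0 : 0 < c := lt_of_lt_of_le h hc
    have h1 := Real.log_le_sub_one_of_pos (div_pos (mul_pos hr0 hc0) h)
    rw [Real.log_div (mul_pos hr0 hc0).ne' h.ne', Real.log_mul hr0.ne' hc0.ne'] at h1
    have h2 := mul_le_mul_of_nonneg_left h1 h.le
    have h3 : p * (r * c / p - 1) = r * c - p := by field_simp
    rw [h3] at h2
    linarith

/-- Subadditivity in the form needed: `w = p00`, `x = p01`, `y = p10`, `z = p11`. -/
lemma real_ineq (w x y z : ℝ) (hw : 0 ≤ w) (hx : 0 ≤ x) (hy : 0 ≤ y) (hz : 0 ≤ z)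
    (hs : w + x + y + z = 1) :
    (w + z) * Real.log (w + z) + (x + y) * Real.log (x + y)
      + (w + y) * Real.log (w + y) + (x + z) * Real.log (x + z)
      ≤ w * Real.log w + x * Real.log x + y * Real.log y + z * Real.log z := by
  have h1 := gibbs_cell w (w + z) (w + y) hw (by linarith) (by linarith)
  have h2 := gibbs_cell z (w + z) (x + z) hz (by linarith) (by linarith)
  have h3 := gibbs_cell x (x + y) (x + z) hx (by linarith) (by linarith)
  have h4 := gibbs_cell y (x + y) (w + y) hy (by linarith) (by linarith)
  have h5 : (w + z) * (w + y) + (w + z) * (x + z) + (x + y) * (x + z) + (x + y) * (w + y) = 1 := by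
    have : (w + z) * (w + y) + (w + z) * (x + z) + (x + y) * (x + z) + (x + y) * (w + y)
      = (w + x + y + z) ^ 2 := by ring
    rw [this, hs]; norm_num
  linarith

lemma single_info {Ω : Type*} [MeasurableSpace Ω] (ν : Measure Ω) [IsProbabilityMeasure ν]
    (A B : Ω → Bool) (hA : Measurable A) (hB : Measurable B)
    (hu : ν (A ⁻¹' {true}) = ν (A ⁻¹' {false})) :
    1 - binEnt ((ν {ω | B ω = A ω}).toReal) ≤ mutualInfo ν A B := by
  set f : Ω → Bool × Bool := fun ω => (A ω, B ω) with hf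
  have hfm : Measurable f := hA.prodMk hB
  have key : ∀ s : Finset (Bool × Bool),
      (ν (f ⁻¹' (s : Set (Bool × Bool)))).toReal = ∑ q ∈ s, (ν (f ⁻¹' {q})).toReal := by
    intro s
    rw [← sum_measure_preimage_singleton s (fun y _ => hfm (measurableSet_singleton y)),
      ENNReal.toReal_sum (fun _ _ => measure_ne_top _ _)]
  set p : Bool × Bool → ℝ := fun q => (ν (f ⁻¹' {q})).toReal with hp
  have hp0 : ∀ q, 0 ≤ p q := fun q => ENNReal.toReal_nonneg
  have hAt : ∀ x, (ν (A ⁻¹' {x})).toReal = p (x, false) + p (x, true) := by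
    intro x
    have := key {(x, false), (x, true)}
    rw [Finset.sum_pair (by simp)] at this
    rw [← this]; congr 2; ext ω; cases h : B ω <;> simp [hf, h]
  have hBt : ∀ x, (ν (B ⁻¹' {x})).toReal = p (false, x) + p (true, x) := by
    intro x
    have := key {(false, x), (true, x)}
    rw [Finset.sum_pair (by simp)] at this
    rw [← this]; congr 2; ext ω; cases h : A ω <;> simp [hf, h]
  have hE : (ν {ω | B ω = A ω}).toReal = p (false, false) + p (true, true) := by
    have := key {(false, false), (true, true)}
    rw [Finset.sum_pair (by simp)] at this
    rw [← this]; congr 2; ext ω; cases h : A ω <;> cases h' : B ω <;> simp [hf, h, h']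
  have hS : p (false, false) + p (false, true) + p (true, false) + p (true, true) = 1 := by
    have := key Finset.univ
    rw [Fintype.sum_prod_type] at this
    simp at this
    linarith
  have hh : p (true, false) + p (true, true) = p (false, false) + p (false, true) := by
    rw [← hAt, ← hAt, hu]
  have hmain := real_ineq _ _ _ _ (hp0 (false, false)) (hp0 (false, true)) (hp0 (true, false))
    (hp0 (true, true)) hS
  have e1 : p (true, false) + p (true, true) = 1 / 2 := by linarith
  have e2 : p (false, false) + p (false, true) = 1 / 2 := by linarith
  have hlog : Real.logb 2 (1 / 2) = -1 := by
    rw [one_div, Real.logb_inv, Real.logb_self_eq_one (by norm_num)]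
  have hHA : entropy ν A = 1 := by
    unfold entropy
    simp only [Fintype.sum_bool, hAt, e1, e2, hlog]; norm_num
  unfold mutualInfo
  rw [hHA, hE]
  unfold entropy binEnt
  rw [Fintype.sum_prod_type]
  simp only [Fintype.sum_bool, hBt]
  change _ ≤ 1 + _ - -(p (true, true) * Real.logb 2 (p (true, true))
    + p (true, false) * Real.logb 2 (p (true, false))
    + (p (false, true) * Real.logb 2 (p (false, true))
    + p (false, false) * Real.logb 2 (p (false, false))))
  have e3 : 1 - (p (false, false) + p (true, true)) = p (false, true) + p (true, false) := by
    linarith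
  rw [e3]
  have hl : 0 < Real.log 2 := Real.log_pos (by norm_num)
  have h6 := div_le_div_of_nonneg_right hmain hl.le
  simp only [add_div, mul_div_assoc, Real.log_div_log] at h6
  linarith

/-- For independent unbiased database bits `a₀,…,a_{N-1}`, an independent
uniform query `b`, and any `{0,1}`-valued output `β`, the information score satisfies
`Σ_K I(a_K : β | b = K) ≥ N - Σ_K h(P_K)` where `P_K = Pr[β = a_K | b = K]`. -/
theorem rac_accuracy_to_information
    {Ω : Type*} [MeasurableSpace Ω] (μ : Measure Ω) [IsProbabilityMeasure μ]
    (N : ℕ) (hN : 0 < N)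
    (a : Fin N → Ω → Bool) (b : Ω → Fin N) (β : Ω → Bool)
    (ha : ∀ i, Measurable (a i)) (hb : Measurable b) (hβ : Measurable β)
    (hjoint : ∀ (v : Fin N → Bool) (K : Fin N),
      μ {ω | (∀ i, a i ω = v i) ∧ b ω = K} = ((1 : ℝ≥0∞) / 2) ^ N * ((N : ℝ≥0∞))⁻¹) :
    (N : ℝ) - ∑ K : Fin N, binEnt ((μ[|b ⁻¹' {K}] {ω | β ω = a K ω}).toReal)
      ≤ ∑ K : Fin N, mutualInfo (μ[|b ⁻¹' {K}]) (a K) β := by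
  have hcpos : ((1 : ℝ≥0∞) / 2) ^ N * ((N : ℝ≥0∞))⁻¹ ≠ 0 := by
    refine mul_ne_zero (pow_ne_zero _ ?_) ?_ <;> simp
  have hbK : ∀ K, μ (b ⁻¹' {K}) ≠ 0 := by
    intro K h0
    apply hcpos
    rw [← hjoint (fun _ => true) K]
    exact measure_mono_null (fun ω h => h.2) h0
  have hcnt : ∀ (K : Fin N) (x : Bool), μ (b ⁻¹' {K} ∩ (a K) ⁻¹' {x})
      = ∑ v : Fin N → Bool, if v K = x then ((1 : ℝ≥0∞) / 2) ^ N * ((N : ℝ≥0∞))⁻¹ else 0 := by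
    intro K x
    set f : Ω → (Fin N → Bool) × Fin N := fun ω => (fun i => a i ω, b ω) with hf
    have hfm : Measurable f := (measurable_pi_lambda _ ha).prodMk hb
    have h := sum_measure_preimage_singleton (μ := μ) (f := f)
      ((Finset.univ.filter (fun v : Fin N → Bool => v K = x)) ×ˢ {K})
      (fun y _ => hfm (measurableSet_singleton y))
    rw [Finset.sum_product] at h
    simp only [Finset.sum_singleton, Finset.sum_filter] at h
    have hset : f ⁻¹' (((Finset.univ.filter (fun v : Fin N → Bool => v K = x)) ×ˢ {K} :
        Finset ((Fin N → Bool) × Fin N)) : Set ((Fin N → Bool) × Fin N))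
        = b ⁻¹' {K} ∩ (a K) ⁻¹' {x} := by
      ext ω; simp [hf, and_comm, eq_comm]
    rw [hset] at h
    rw [← h]
    refine Finset.sum_congr rfl fun v _ => ?_
    rw [← hjoint v K]
    have : f ⁻¹' {(v, K)} = {ω | (∀ i, a i ω = v i) ∧ b ω = K} := by
      ext ω; simp [hf, funext_iff]
    rw [this]
  have hsum : (N : ℝ) = ∑ K : Fin N, (1 : ℝ) := by simp
  rw [hsum, ← Finset.sum_sub_distrib]
  refine Finset.sum_le_sum fun K _ => ?_
  have : IsProbabilityMeasure (μ[|b ⁻¹' {K}]) := cond_isProbabilityMeasure (hbK K)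
  refine single_info _ _ _ (ha K) hβ ?_
  have hm : MeasurableSet (b ⁻¹' {K}) := hb (measurableSet_singleton K)
  rw [cond_apply hm, cond_apply hm, hcnt, hcnt]
  congr 1
  refine Fintype.sum_equiv (Equiv.arrowCongr (Equiv.refl _) Equiv.boolNot) _ _ fun v => ?_
  simp [Equiv.arrowCongr]
end

section
/- Let Λ be a finite probability space of hidden variables and let A : {0,1} × Λ → {0,1} and B : {0,1} × Λ → {0,1} be arbitrary response functions (a local hidden-variable model). Then Σ_{s,t ∈ {0,1}} Pr_λ[A(s,λ) ⊕ B(t,λ) = s·t] ≤ 3. -/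
/-- Local hidden-variable bound for CHSH: for any finite probability space `Λ`
of hidden variables and arbitrary response functions `A, B : {0,1} × Λ → {0,1}`,
`Σ_{s,t} Pr_λ[A(s,λ) ⊕ B(t,λ) = s·t] ≤ 3`. -/
theorem chsh_local_bound {Λ : Type*} [Fintype Λ]
    (p : Λ → ℝ) (hp : ∀ l, 0 ≤ p l) (hsum : ∑ l : Λ, p l = 1)
    (A B : Bool → Λ → Bool) :
    (∑ s : Bool, ∑ t : Bool, ∑ l : Λ,
        if xor (A s l) (B t l) = (s && t) then p l else 0) ≤ 3 := by
  have h3 : (3 : ℝ) = ∑ l : Λ, 3 * p l := by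
    rw [← Finset.mul_sum, hsum, mul_one]
  rw [h3]
  simp only [Fintype.sum_bool, ← Finset.sum_add_distrib]
  apply Finset.sum_le_sum
  intro l _
  have h := hp l
  cases A true l <;> cases A false l <;> cases B true l <;> cases B false l <;>
    simp <;> linarith
end

section
/- Consider a classical random access coding protocol: the database a = (a₀,…,a_{N−1}) is uniformly distributed on {0,1}^N; (R_A, R_B) is a pair of finitely-valued shared-randomness variables independent of a; the message is x = Enc(a, R_A) ∈ {0,1}^m for a deterministic function Enc; the query b is uniform on {0,…,N−1} and independent of (a, R_A, R_B); and the output is β = Dec(x, R_B, b) ∈ {0,1} for a deterministic function Dec. Then the information score satisfies Σ_{K=0}^{N−1} I(a_K : β | b = K) ≤ m. -/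
open MeasureTheory ProbabilityTheory
open scoped ENNReal

lemma rac_sum_fiber {W : Type*} [Fintype W] (p : W → ℝ) (f g : W → Bool) (F : Bool → Bool → ℝ) :
    ∑ w, p w * F (f w) (g w)
      = ∑ u, ∑ y, (∑ w, if f w = u ∧ g w = y then p w else 0) * F u y := by
  simp only [Fintype.sum_bool, Finset.sum_mul, ← Finset.sum_add_distrib]
  refine Finset.sum_congr rfl fun w _ => ?_
  cases f w <;> cases g w <;> simp

lemma rac_ent_bool (x y : ℝ) (h : x + y = 1) :
    -(x * Real.log x + y * Real.log y) ≤ Real.log 2 := by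
  have := Real.binEntropy_le_log_two (p := x)
  rw [Real.binEntropy_eq_negMulLog_add_negMulLog_one_sub] at this
  have hy : y = 1 - x := by linarith
  subst hy
  simp only [Real.negMulLog] at this
  linarith

/-- Per-query bound, with natural logarithms. -/
lemma rac_term {W : Type*} [Fintype W] (p : W → ℝ) (hp : ∀ w, 0 ≤ p w) (hp1 : ∑ w, p w = 1)
    (f g : W → Bool) (c : Bool → Bool → ℝ) (A d : Bool → ℝ)
    (hc : ∀ u y, c u y = ∑ w, if f w = u ∧ g w = y then p w else 0)
    (hA : ∀ u, A u = ∑ w, if f w = u then p w else 0)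
    (hd : ∀ y, d y = ∑ w, if g w = y then p w else 0) :
    (∀ u y, 0 ≤ c u y) ∧ (∀ y, d y = c true y + c false y) ∧
    (-∑ u, A u * Real.log (A u)) + (-∑ y, d y * Real.log (d y))
        - (-∑ z : Bool × Bool, c z.1 z.2 * Real.log (c z.1 z.2))
      ≤ ∑ w, p w * Real.log (2 * (c (f w) (g w) / d (g w))) := by
  have hc0 : ∀ u y, 0 ≤ c u y := by
    intro u y
    rw [hc]
    refine Finset.sum_nonneg fun w _ => ?_
    split_ifs
    · exact hp w
    · exact le_rfl
  have hdc : ∀ y, d y = c true y + c false y := by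
    intro y
    rw [hd, hc, hc, ← Finset.sum_add_distrib]
    refine Finset.sum_congr rfl fun w _ => ?_
    cases f w <;> simp
  have hA1 : A true + A false = 1 := by
    rw [hA, hA, ← Finset.sum_add_distrib, ← hp1]
    refine Finset.sum_congr rfl fun w _ => ?_
    cases f w <;> simp
  have hd1 : d true + d false = 1 := by
    rw [hd, hd, ← Finset.sum_add_distrib, ← hp1]
    refine Finset.sum_congr rfl fun w _ => ?_
    cases g w <;> simp
  refine ⟨hc0, hdc, ?_⟩
  have hA2 := rac_ent_bool _ _ hA1
  rw [rac_sum_fiber p f g (fun u y => Real.log (2 * (c u y / d y)))]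
  simp only [← hc]
  have key : ∀ u y, c u y * Real.log (2 * (c u y / d y))
      = c u y * Real.log 2 + c u y * Real.log (c u y) - c u y * Real.log (d y) := by
    intro u y
    rcases (hc0 u y).eq_or_lt with h | h
    · rw [← h]; simp
    · have hdpos : 0 < d y := by
        have h1 := hc0 true y
        have h2 := hc0 false y
        rw [hdc]
        cases u <;> linarith
      rw [Real.log_mul (by norm_num) (by positivity), Real.log_div h.ne' hdpos.ne']
      ring
  simp only [key, Fintype.sum_prod_type, Fintype.sum_bool]
  have e1 := hdc true
  have e2 := hdc false
  have e3 : c true true + c false true + (c true false + c false false) = 1 := by linarith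
  have e4 : d true * Real.log (d true)
      = c true true * Real.log (d true) + c false true * Real.log (d true) := by
    rw [← add_mul, ← e1]
  have e5 : d false * Real.log (d false)
      = c true false * Real.log (d false) + c false false * Real.log (d false) := by
    rw [← add_mul, ← e2]
  have e6 : c true true * Real.log 2 + c false true * Real.log 2 + (c true false * Real.log 2
      + c false false * Real.log 2) = Real.log 2 := by
    rw [← add_mul, ← add_mul, ← add_mul, e3, one_mul]
  linarith

lemma rac_finite (N m : ℕ) {S T : Type*} [Fintype S] [Fintype T]
    (Enc : (Fin N → Bool) → S → (Fin m → Bool))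
    (Dec : (Fin m → Bool) → T → Fin N → Bool)
    (r : S × T → ℝ) (hr : ∀ z, 0 ≤ r z) (hr1 : ∑ z, r z = 1)
    (Q : Fin N → Bool → Bool → ℝ) (hQ : ∀ K u y, 0 ≤ Q K u y)
    (hQ1 : ∀ K y, Q K true y + Q K false y ≤ 1)
    (hpos : ∀ (w : (Fin N → Bool) × (S × T)) (K : Fin N), 0 < r w.2 →
      0 < Q K (w.1 K) (Dec (Enc w.1 w.2.1) w.2.2 K))
    (hp1 : ∑ w : (Fin N → Bool) × (S × T), (1 / 2 : ℝ) ^ N * r w.2 = 1) :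
    ∑ K, ∑ w : (Fin N → Bool) × (S × T), ((1 / 2 : ℝ) ^ N * r w.2) *
      Real.log (2 * Q K (w.1 K) (Dec (Enc w.1 w.2.1) w.2.2 K)) ≤ m * Real.log 2 := by
  rw [Finset.sum_comm]
  have hQx : ∀ x t, ∑ v : Fin N → Bool, ∏ K, Q K (v K) (Dec x t K) ≤ 1 := by
    intro x t
    have := Finset.prod_univ_sum (fun _ : Fin N => (Finset.univ : Finset Bool))
      (fun K u => Q K u (Dec x t K))
    rw [Fintype.piFinset_univ] at this
    rw [← this]
    refine Finset.prod_le_one (fun K _ => Finset.sum_nonneg fun u _ => hQ _ _ _) fun K _ => ?_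
    rw [Fintype.sum_bool]
    exact hQ1 _ _
  have step : ∀ w : (Fin N → Bool) × (S × T),
      ∑ K, ((1 / 2 : ℝ) ^ N * r w.2) *
        Real.log (2 * Q K (w.1 K) (Dec (Enc w.1 w.2.1) w.2.2 K))
      ≤ r w.2 * (∏ K, Q K (w.1 K) (Dec (Enc w.1 w.2.1) w.2.2 K)) / 2 ^ m
        + ((1 / 2 : ℝ) ^ N * r w.2) * (m * Real.log 2 - 1) := by
    intro w
    rcases (hr w.2).eq_or_lt with h | h
    · rw [← h]; simp
    · rw [← Finset.mul_sum, ← Real.log_prod (fun K _ => by have := hpos w K h; positivity),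
        Finset.prod_mul_distrib]
      have hP : 0 < ∏ K, Q K (w.1 K) (Dec (Enc w.1 w.2.1) w.2.2 K) :=
        Finset.prod_pos fun K _ => hpos w K h
      set P := ∏ K, Q K (w.1 K) (Dec (Enc w.1 w.2.1) w.2.2 K)
      simp only [Finset.prod_const, Finset.card_univ, Fintype.card_fin]
      have hl := Real.log_le_sub_one_of_pos (x := 2 ^ N * P / 2 ^ m) (by positivity)
      rw [Real.log_div (by positivity) (by positivity), Real.log_pow] at hl
      have h3 : Real.log (2 ^ N * P) ≤ 2 ^ N * P / 2 ^ m + (m * Real.log 2 - 1) := by linarith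
      have h4 := mul_le_mul_of_nonneg_left h3 (a := (1 / 2 : ℝ) ^ N * r w.2) (by positivity)
      refine h4.trans (le_of_eq ?_)
      rw [mul_add]
      congr 1
      have : (1 / 2 : ℝ) ^ N * 2 ^ N = 1 := by rw [← mul_pow]; norm_num
      calc _ = ((1 / 2 : ℝ) ^ N * 2 ^ N) * (r w.2 * P / 2 ^ m) := by ring
        _ = _ := by rw [this, one_mul]
  refine (Finset.sum_le_sum fun w _ => step w).trans ?_
  rw [Finset.sum_add_distrib, ← Finset.sum_mul, hp1, ← Finset.sum_div]
  have hb : ∑ w : (Fin N → Bool) × (S × T),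
      r w.2 * (∏ K, Q K (w.1 K) (Dec (Enc w.1 w.2.1) w.2.2 K)) ≤ 2 ^ m := by
    rw [Fintype.sum_prod_type, Finset.sum_comm]
    have : ∀ z : S × T, ∑ v : Fin N → Bool, r z * (∏ K, Q K (v K) (Dec (Enc v z.1) z.2 K))
        ≤ r z * 2 ^ m := by
      intro z
      rw [← Finset.mul_sum]
      refine mul_le_mul_of_nonneg_left ?_ (hr z)
      calc ∑ v : Fin N → Bool, ∏ K, Q K (v K) (Dec (Enc v z.1) z.2 K)
          ≤ ∑ v : Fin N → Bool, ∑ x : Fin m → Bool, ∏ K, Q K (v K) (Dec x z.2 K) := by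
            refine Finset.sum_le_sum fun v _ => ?_
            exact Finset.single_le_sum (f := fun x => ∏ K, Q K (v K) (Dec x z.2 K))
              (fun x _ => Finset.prod_nonneg fun K _ => hQ _ _ _) (Finset.mem_univ (Enc v z.1))
        _ = ∑ x : Fin m → Bool, ∑ v : Fin N → Bool, ∏ K, Q K (v K) (Dec x z.2 K) :=
            Finset.sum_comm
        _ ≤ ∑ x : Fin m → Bool, (1 : ℝ) := Finset.sum_le_sum fun x _ => hQx x z.2
        _ = 2 ^ m := by simp
    refine (Finset.sum_le_sum fun z _ => this z).trans ?_
    rw [← Finset.sum_mul, hr1, one_mul]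
  have hb2 : (∑ w : (Fin N → Bool) × (S × T),
      r w.2 * (∏ K, Q K (w.1 K) (Dec (Enc w.1 w.2.1) w.2.2 K))) / 2 ^ m ≤ 1 := by
    rw [div_le_one (by positivity)]
    exact hb
  linarith

/-- **information causality for classical RAC.** Database `a` uniform on
`{0,1}^N`; shared randomness `(R_A, R_B)` independent of `a`; message `x = Enc(a, R_A)` of
`m` bits; query `b` uniform and independent of `(a, R_A, R_B)`; output `β = Dec(x, R_B, b)`.
Then `Σ_K I(a_K : β | b = K) ≤ m`. -/
theorem classical_rac_information_causality
    {Ω : Type*} [MeasurableSpace Ω] (μ : Measure Ω) [IsProbabilityMeasure μ]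
    (N m : ℕ) (hN : 0 < N)
    {S T : Type*} [Fintype S] [Fintype T]
    [MeasurableSpace S] [MeasurableSingletonClass S]
    [MeasurableSpace T] [MeasurableSingletonClass T]
    (a : Fin N → Ω → Bool) (RA : Ω → S) (RB : Ω → T) (b : Ω → Fin N)
    (Enc : (Fin N → Bool) → S → (Fin m → Bool))
    (Dec : (Fin m → Bool) → T → Fin N → Bool)
    (β : Ω → Bool)
    (ha : ∀ i, Measurable (a i)) (hRA : Measurable RA) (hRB : Measurable RB)
    (hb : Measurable b)
    (hβ : β = fun ω => Dec (Enc (fun i => a i ω) (RA ω)) (RB ω) (b ω))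
    (hjoint : ∀ (v : Fin N → Bool) (K : Fin N) (s : S) (t : T),
      μ {ω | (∀ i, a i ω = v i) ∧ b ω = K ∧ RA ω = s ∧ RB ω = t}
        = ((1 : ℝ≥0∞) / 2) ^ N * ((N : ℝ≥0∞))⁻¹ * μ {ω | RA ω = s ∧ RB ω = t}) :
    ∑ K : Fin N, mutualInfo (μ[|b ⁻¹' {K}]) (a K) β ≤ (m : ℝ) := by
  classical
  set r : S × T → ℝ := fun z => μ.real {ω | RA ω = z.1 ∧ RB ω = z.2} with hrdef
  set p : (Fin N → Bool) × (S × T) → ℝ := fun w => (1 / 2 : ℝ) ^ N * r w.2 with hpdef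
  set Z : Ω → (Fin N → Bool) × (S × T) := fun ω => (fun i => a i ω, RA ω, RB ω) with hZ
  have hr : ∀ z, 0 ≤ r z := fun z => measureReal_nonneg
  have hZm : Measurable Z := by
    refine Measurable.prodMk (measurable_pi_iff.2 ha) (hRA.prodMk hRB)
  have hr1 : ∑ z, r z = 1 := by
    have := sum_measureReal_preimage_singleton (μ := μ) (f := fun ω => (RA ω, RB ω))
      (Finset.univ : Finset (S × T))
      (fun y _ => (hRA.prodMk hRB) (measurableSet_singleton y))
    simp only [Finset.coe_univ, Set.preimage_univ, probReal_univ] at this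
    rw [← this]
    refine Finset.sum_congr rfl fun z _ => ?_
    have e : {ω | RA ω = z.1 ∧ RB ω = z.2} = (fun ω => (RA ω, RB ω)) ⁻¹' {z} := by
      ext ω
      simp [Prod.ext_iff]
    simp only [hrdef, e]
  have hp : ∀ w, 0 ≤ p w := fun w => mul_nonneg (by positivity) (hr _)
  have hp1 : ∑ w, p w = 1 := by
    rw [Fintype.sum_prod_type]
    simp only [hpdef, ← Finset.mul_sum, hr1]
    simp
  have hNpos : (0 : ℝ) < N := by exact_mod_cast hN
  have hatom : ∀ K w, μ.real (b ⁻¹' {K} ∩ Z ⁻¹' {w}) = (N : ℝ)⁻¹ * p w := by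
    intro K w
    have h := congrArg ENNReal.toReal (hjoint w.1 K w.2.1 w.2.2)
    have e : b ⁻¹' {K} ∩ Z ⁻¹' {w}
        = {ω | (∀ i, a i ω = w.1 i) ∧ b ω = K ∧ RA ω = w.2.1 ∧ RB ω = w.2.2} := by
      ext ω
      simp only [hZ, Set.mem_inter_iff, Set.mem_preimage, Set.mem_singleton_iff, Prod.ext_iff,
        Set.mem_ofPred_eq, funext_iff]
      tauto
    rw [e, Measure.real, h]
    simp only [ENNReal.toReal_mul, ENNReal.toReal_pow, ENNReal.toReal_inv, ENNReal.toReal_natCast,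
      hpdef, hrdef, Measure.real, ENNReal.toReal_div, ENNReal.toReal_one, ENNReal.toReal_ofNat]
    ring
  have hset : ∀ K (A : (Fin N → Bool) × (S × T) → Prop) [DecidablePred A],
      μ.real (b ⁻¹' {K} ∩ Z ⁻¹' {w | A w}) = (N : ℝ)⁻¹ * ∑ w, if A w then p w else 0 := by
    intro K A _
    rw [← Finset.sum_filter, Finset.mul_sum]
    have := sum_measureReal_preimage_singleton (μ := μ.restrict (b ⁻¹' {K})) (f := Z)
      (Finset.univ.filter A) (fun y _ => hZm (measurableSet_singleton y))
    have e : ((Finset.univ.filter A : Finset _) : Set ((Fin N → Bool) × (S × T)))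
      = {w | A w} := by ext; simp
    rw [e] at this
    rw [Set.inter_comm, ← measureReal_restrict_apply (hZm (Set.toFinite _).measurableSet), ← this]
    refine Finset.sum_congr rfl fun w _ => ?_
    rw [measureReal_restrict_apply (hZm (measurableSet_singleton w)), Set.inter_comm, hatom]
  have hbK : ∀ K, μ.real (b ⁻¹' {K}) = (N : ℝ)⁻¹ := by
    intro K
    have := hset K (fun _ => True)
    simpa [hp1] using this
  have hcond : ∀ K (B : Set Ω) (A : (Fin N → Bool) × (S × T) → Prop) [DecidablePred A],
      (∀ ω, b ω = K → (ω ∈ B ↔ A (Z ω))) →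
      ((μ[|b ⁻¹' {K}]) B).toReal = ∑ w, if A w then p w else 0 := by
    intro K B A _ h
    rw [cond_apply (hb (measurableSet_singleton K)), ENNReal.toReal_mul, ENNReal.toReal_inv]
    have e : b ⁻¹' {K} ∩ B = b ⁻¹' {K} ∩ Z ⁻¹' {w | A w} := by
      ext ω
      simp only [Set.mem_inter_iff, Set.mem_preimage, Set.mem_singleton_iff, Set.mem_ofPred_eq]
      exact and_congr_right (h ω)
    have h1 := hbK K
    have h2 := hset K A
    rw [Measure.real] at h1 h2
    rw [e, h1, h2, inv_inv, ← mul_assoc, mul_inv_cancel₀ hNpos.ne', one_mul]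
  let f : Fin N → (Fin N → Bool) × (S × T) → Bool := fun K w => w.1 K
  let g : Fin N → (Fin N → Bool) × (S × T) → Bool :=
    fun K w => Dec (Enc w.1 w.2.1) w.2.2 K
  let c : Fin N → Bool → Bool → ℝ :=
    fun K u y => ∑ w, if f K w = u ∧ g K w = y then p w else 0
  let A : Fin N → Bool → ℝ := fun K u => ∑ w, if f K w = u then p w else 0
  let d : Fin N → Bool → ℝ := fun K y => ∑ w, if g K w = y then p w else 0
  have hT := fun K => rac_term p hp hp1 (f K) (g K) (c K) (A K) (d K)
    (fun _ _ => rfl) (fun _ => rfl) (fun _ => rfl)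
  have hMI : ∀ K, mutualInfo (μ[|b ⁻¹' {K}]) (a K) β * Real.log 2
      = (-∑ u, A K u * Real.log (A K u)) + (-∑ y, d K y * Real.log (d K y))
        - (-∑ z : Bool × Bool, c K z.1 z.2 * Real.log (c K z.1 z.2)) := by
    intro K
    have hl : Real.log 2 ≠ 0 := (Real.log_pos (by norm_num)).ne'
    have h1 : ∀ u, ((μ[|b ⁻¹' {K}]) (a K ⁻¹' {u})).toReal = A K u := fun u =>
      hcond K _ (fun w => f K w = u) (fun ω _ => Iff.rfl)
    have h2 : ∀ y, ((μ[|b ⁻¹' {K}]) (β ⁻¹' {y})).toReal = d K y := fun y =>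
      hcond K _ (fun w => g K w = y) (fun ω h => by subst hβ; subst h; exact Iff.rfl)
    have h3 : ∀ z : Bool × Bool,
        ((μ[|b ⁻¹' {K}]) ((fun ω => (a K ω, β ω)) ⁻¹' {z})).toReal = c K z.1 z.2 := fun z =>
      hcond K _ (fun w => f K w = z.1 ∧ g K w = z.2)
        (fun ω h => by subst hβ; subst h; exact Prod.ext_iff)
    simp only [mutualInfo, entropy, h1, h2, h3]
    rw [sub_mul, add_mul, neg_mul, neg_mul, neg_mul, Finset.sum_mul, Finset.sum_mul,
      Finset.sum_mul]
    simp only [Real.logb, mul_assoc, div_mul_cancel₀ _ hl]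
  have hlog : 0 < Real.log 2 := Real.log_pos (by norm_num)
  refine le_of_mul_le_mul_right ?_ hlog
  rw [Finset.sum_mul]
  refine (Finset.sum_le_sum fun K _ => (hMI K).le.trans (hT K).2.2).trans ?_
  have hd0 : ∀ K y, 0 ≤ d K y := fun K y => by
    rw [(hT K).2.1]
    exact add_nonneg ((hT K).1 _ _) ((hT K).1 _ _)
  refine rac_finite N m Enc Dec r hr hr1 (fun K u y => c K u y / d K y)
    (fun K u y => div_nonneg ((hT K).1 u y) (hd0 K y)) ?_ ?_ hp1
  · intro K y
    rw [← add_div, ← (hT K).2.1]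
    exact div_self_le_one _
  · intro w K h
    have hpw : 0 < p w := mul_pos (by positivity) h
    have hcp : 0 < c K (f K w) (g K w) := by
      refine Finset.sum_pos' (fun w' _ => ?_) ⟨w, Finset.mem_univ _, by simpa using hpw⟩
      split_ifs
      · exact hp _
      · exact le_rfl
    have hdp : 0 < d K (g K w) := by
      refine Finset.sum_pos' (fun w' _ => ?_) ⟨w, Finset.mem_univ _, by simpa using hpw⟩
      split_ifs
      · exact hp _
      · exact le_rfl
    exact div_pos hcp hdp
end

section
/- Let a = (a₀,…,a_{N−1}) be a vector of independent uniformly distributed {0,1}-valued random variables, let H and B be finitely-valued random variables (the bottleneck representation and the decoder-side resource), let b be uniform on {0,…,N−1} and independent of (a, H, B), and let the output be β = Dec(H, B, b, R) ∈ {0,1} for a deterministic function Dec and a finitely-valued noise variable R independent of (a, H, B, b). Then the Neural-RAC score satisfies Σ_{K=0}^{N−1} I(a_K : β | b = K) ≤ I(a : (H, B)). -/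
open MeasureTheory ProbabilityTheory
open scoped ENNReal

lemma core_ineq (N : ℕ) {X : Type*} [Fintype X] (p : (Fin N → Bool) → X → ℝ)
    (hp : ∀ v x, 0 ≤ p v x) (hm : ∀ v, ∑ x, p v x = (1 / 2 : ℝ) ^ N)
    (w : Fin N → X → Bool → ℝ) (hw : ∀ K x y, 0 ≤ w K x y) (hw1 : ∀ K x, ∑ y, w K x y = 1)
    (q : Fin N → Bool → Bool → ℝ)
    (hq : ∀ K c y, q K c y = ∑ v, ∑ x, if v K = c then p v x * w K x y else 0)
    (hqc : ∀ K c, ∑ y, q K c y = 1 / 2) :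
    ∑ K, (∑ c, ∑ y, q K c y * Real.log (q K c y)
        - ∑ c, (∑ y, q K c y) * Real.log (∑ y, q K c y)
        - ∑ y, (∑ c, q K c y) * Real.log (∑ c, q K c y))
      ≤ ∑ v, ∑ x, p v x * Real.log (p v x)
        - ∑ v, (∑ x, p v x) * Real.log (∑ x, p v x)
        - ∑ x, (∑ v, p v x) * Real.log (∑ v, p v x) := by
  classical
  have hq0 : ∀ K c y, 0 ≤ q K c y := by
    intro K c y
    rw [hq]
    refine Finset.sum_nonneg fun v _ => Finset.sum_nonneg fun x _ => ?_
    split_ifs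
    · exact mul_nonneg (hp _ _) (hw _ _ _)
    · exact le_rfl
  obtain ⟨qy, hqy⟩ : ∃ qy : Fin N → Bool → ℝ, ∀ K y, qy K y = ∑ c, q K c y := ⟨_, fun _ _ => rfl⟩
  obtain ⟨px, hpx⟩ : ∃ px : X → ℝ, ∀ x, px x = ∑ v, p v x := ⟨_, fun _ => rfl⟩
  have hqy0 : ∀ K y, 0 ≤ qy K y := fun K y => by
    rw [hqy]; exact Finset.sum_nonneg fun c _ => hq0 _ _ _
  have hqle : ∀ K c y, q K c y ≤ qy K y := fun K c y => by
    rw [hqy]; exact Finset.single_le_sum (f := fun c => q K c y) (fun c _ => hq0 _ _ _) (Finset.mem_univ c)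
  have hpx0 : ∀ x, 0 ≤ px x := fun x => by
    rw [hpx]; exact Finset.sum_nonneg fun c _ => hp _ _
  have hple : ∀ v x, p v x ≤ px x := fun v x => by
    rw [hpx]; exact Finset.single_le_sum (f := fun v => p v x) (fun c _ => hp _ _) (Finset.mem_univ v)
  have hqterm : ∀ K v x y, p v x * w K x y ≤ q K (v K) y := by
    intro K v x y
    have hnn : ∀ v' x', 0 ≤ (if v' K = v K then p v' x' * w K x' y else 0) := by
      intro v' x'
      split_ifs
      · exact mul_nonneg (hp _ _) (hw _ _ _)
      · exact le_rfl
    rw [hq]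
    refine le_trans ?_ (Finset.single_le_sum
      (f := fun v' => ∑ x', if v' K = v K then p v' x' * w K x' y else 0)
      (fun v' _ => Finset.sum_nonneg fun x' _ => hnn v' x') (Finset.mem_univ v))
    refine le_trans ?_ (Finset.single_le_sum
      (f := fun x' => if v K = v K then p v x' * w K x' y else 0)
      (fun x' _ => hnn v x') (Finset.mem_univ x))
    simp
  obtain ⟨g, hg⟩ : ∃ g : Fin N → Bool → X → ℝ,
      ∀ K c x, g K c x = ∑ y, w K x y * (q K c y / qy K y) := ⟨_, fun _ _ _ => rfl⟩
  have hg0 : ∀ K c x, 0 ≤ g K c x := fun K c x => by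
    rw [hg]
    exact Finset.sum_nonneg fun y _ => mul_nonneg (hw _ _ _) (div_nonneg (hq0 _ _ _) (hqy0 _ _))
  have hgsum : ∀ K x, ∑ c, g K c x ≤ 1 := by
    intro K x
    simp_rw [hg]
    rw [Finset.sum_comm, ← hw1 K x]
    refine Finset.sum_le_sum fun y _ => ?_
    rw [← Finset.mul_sum, ← Finset.sum_div, ← hqy]
    exact mul_le_of_le_one_right (hw _ _ _) (div_self_le_one _)
  have hprod : ∀ x, ∑ v : Fin N → Bool, ∏ K, g K (v K) x ≤ 1 := by
    intro x
    have := Fintype.prod_sum (fun K c => g K c x)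
    rw [← this]
    exact Finset.prod_le_one (fun K _ => Finset.sum_nonneg fun c _ => hg0 _ _ _)
      (fun K _ => hgsum K x)
  have key : ∀ v x, p v x * (∑ K, ∑ y, w K x y *
        (Real.log 2 + Real.log (q K (v K) y) - Real.log (qy K y)))
      ≤ p v x * (Real.log (p v x) - Real.log (px x) + N * Real.log 2)
        + (px x * ∏ K, g K (v K) x - p v x) := by
    intro v x
    rcases (hp v x).eq_or_lt with h0 | hpos
    · rw [← h0]
      have := mul_nonneg (hpx0 x) (Finset.prod_nonneg fun K (_ : K ∈ Finset.univ) => hg0 K (v K) x)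
      simpa using this
    have hpxpos : 0 < px x := hpos.trans_le (hple v x)
    have hqpos : ∀ K y, 0 < w K x y → 0 < q K (v K) y := fun K y h =>
      (mul_pos hpos h).trans_le (hqterm K v x y)
    have hgpos : ∀ K, 0 < g K (v K) x := by
      intro K
      have : ∃ y, 0 < w K x y := by
        by_contra! hc
        have h1 := hw1 K x
        have : ∑ y, w K x y ≤ 0 := Finset.sum_nonpos fun y _ => hc y
        linarith
      obtain ⟨y, hy⟩ := this
      rw [hg]
      refine Finset.sum_pos' (fun y _ => mul_nonneg (hw _ _ _) (div_nonneg (hq0 _ _ _) (hqy0 _ _)))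
        ⟨y, Finset.mem_univ _, ?_⟩
      exact mul_pos hy (div_pos (hqpos K y hy) ((hqpos K y hy).trans_le (hqle _ _ _)))
    have hjen : ∀ K, ∑ y, w K x y * (Real.log 2 + Real.log (q K (v K) y) - Real.log (qy K y))
        ≤ Real.log 2 + Real.log (g K (v K) x) := by
      intro K
      have hterm : ∀ y, w K x y * (Real.log 2 + Real.log (q K (v K) y) - Real.log (qy K y))
          ≤ w K x y * (Real.log 2 + Real.log (g K (v K) x) - 1)
            + w K x y * (q K (v K) y / qy K y) / g K (v K) x := by
        intro y
        rcases (hw K x y).eq_or_lt with h0 | hwpos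
        · rw [← h0]; simp
        have h1 := hqpos K y hwpos
        have h2 := h1.trans_le (hqle K (v K) y)
        have h3 := Real.log_le_sub_one_of_pos (div_pos (div_pos h1 h2) (hgpos K))
        rw [Real.log_div (div_pos h1 h2).ne' (hgpos K).ne', Real.log_div h1.ne' h2.ne'] at h3
        rw [mul_div_assoc, ← mul_add]
        refine mul_le_mul_of_nonneg_left ?_ hwpos.le
        linarith
      refine (Finset.sum_le_sum fun y _ => hterm y).trans ?_
      rw [Finset.sum_add_distrib, ← Finset.sum_mul, ← Finset.sum_div, ← hg, hw1,
        div_self (hgpos K).ne']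
      linarith
    have hsum := Finset.sum_le_sum fun K (_ : K ∈ Finset.univ) => hjen K
    rw [Finset.sum_add_distrib, ← Real.log_prod (fun K _ => (hgpos K).ne')] at hsum
    simp only [Finset.sum_const, Finset.card_univ, Fintype.card_fin, nsmul_eq_mul] at hsum
    have hG : 0 < ∏ K, g K (v K) x := Finset.prod_pos fun K _ => hgpos K
    have h3 := Real.log_le_sub_one_of_pos (div_pos (mul_pos hpxpos hG) hpos)
    rw [Real.log_div (mul_pos hpxpos hG).ne' hpos.ne', Real.log_mul hpxpos.ne' hG.ne'] at h3
    have h4 : p v x * (px x * (∏ K, g K (v K) x) / p v x - 1) = px x * (∏ K, g K (v K) x) - p v x := by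
      field_simp
    rw [← h4, ← mul_add]
    refine mul_le_mul_of_nonneg_left ?_ hpos.le
    linarith
  have hcard : ∑ v : Fin N → Bool, ((1 / 2 : ℝ) ^ N) = 1 := by
    simp
  have hptot : ∑ v, ∑ x, p v x = 1 := by simp_rw [hm]; exact hcard
  have hpxtot : ∑ x, px x = 1 := by simp_rw [hpx]; rw [Finset.sum_comm]; exact hptot
  have hsum := Finset.sum_le_sum fun v (_ : v ∈ Finset.univ) =>
    Finset.sum_le_sum fun x (_ : x ∈ Finset.univ) => key v x
  have hR : ∑ v, ∑ x, (p v x * (Real.log (p v x) - Real.log (px x) + N * Real.log 2)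
        + (px x * (∏ K, g K (v K) x) - p v x))
      ≤ ∑ v, ∑ x, p v x * Real.log (p v x) - ∑ x, px x * Real.log (px x) + N * Real.log 2 := by
    have e1 : ∑ v, ∑ x, (p v x * (Real.log (p v x) - Real.log (px x) + N * Real.log 2)
        + (px x * ∏ K, g K (v K) x - p v x))
        = ∑ v, ∑ x, p v x * Real.log (p v x) - ∑ v, ∑ x, p v x * Real.log (px x)
          + (∑ v, ∑ x, p v x) * (N * Real.log 2)
          + (∑ v : (Fin N → Bool), ∑ x, px x * ∏ K, g K (v K) x - ∑ v, ∑ x, p v x) := by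
      simp only [mul_add, mul_sub, Finset.sum_add_distrib, Finset.sum_sub_distrib, Finset.sum_mul]
    have e2 : ∑ v, ∑ x, p v x * Real.log (px x) = ∑ x, px x * Real.log (px x) := by
      rw [Finset.sum_comm]
      refine Finset.sum_congr rfl fun x _ => ?_
      rw [← Finset.sum_mul, ← hpx]
    have e3 : ∑ v : (Fin N → Bool), ∑ x, px x * ∏ K, g K (v K) x ≤ 1 := by
      rw [Finset.sum_comm, ← hpxtot]
      refine Finset.sum_le_sum fun x _ => ?_
      rw [← Finset.mul_sum]
      exact mul_le_of_le_one_right (hpx0 x) (hprod x)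
    rw [e1, e2, hptot]
    linarith
  have hL : ∑ v, ∑ x, p v x * (∑ K, ∑ y, w K x y *
        (Real.log 2 + Real.log (q K (v K) y) - Real.log (qy K y)))
      = ∑ K, (∑ c, ∑ y, q K c y * (Real.log 2 + Real.log (q K c y) - Real.log (qy K y))) := by
    have e : ∀ K, ∑ c, ∑ y, q K c y * (Real.log 2 + Real.log (q K c y) - Real.log (qy K y))
        = ∑ v, ∑ x, ∑ y, p v x * (w K x y *
        (Real.log 2 + Real.log (q K (v K) y) - Real.log (qy K y))) := by
      intro K
      obtain ⟨f, hf⟩ : ∃ f : Bool → Bool → ℝ, ∀ c y,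
        f c y = Real.log 2 + Real.log (q K c y) - Real.log (qy K y) := ⟨_, fun _ _ => rfl⟩
      simp_rw [← hf, hq]
      simp_rw [Finset.sum_mul]
      calc _ = ∑ c, ∑ v, ∑ x, ∑ y, (if v K = c then p v x * w K x y else 0) * f c y := by
            refine Finset.sum_congr rfl fun c _ => ?_
            rw [Finset.sum_comm]
            refine Finset.sum_congr rfl fun v _ => ?_
            rw [Finset.sum_comm]
        _ = _ := by
            rw [Finset.sum_comm]
            refine Finset.sum_congr rfl fun v _ => ?_
            rw [Finset.sum_comm]
            refine Finset.sum_congr rfl fun x _ => ?_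
            rw [Finset.sum_comm]
            refine Finset.sum_congr rfl fun y _ => ?_
            simp [ite_mul, mul_assoc]
    simp_rw [e, Finset.mul_sum]
    symm
    rw [Finset.sum_comm]
    refine Finset.sum_congr rfl fun v _ => ?_
    rw [Finset.sum_comm]
  rw [hL] at hsum
  have hfin := hsum.trans hR
  have eL : ∀ K, (∑ c, ∑ y, q K c y * Real.log (q K c y)
        - ∑ c, (∑ y, q K c y) * Real.log (∑ y, q K c y)
        - ∑ y, (∑ c, q K c y) * Real.log (∑ c, q K c y))
        = ∑ c, ∑ y, q K c y * (Real.log 2 + Real.log (q K c y) - Real.log (qy K y)) := by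
    intro K
    have a1 : ∑ c, ∑ y, q K c y * Real.log (qy K y) = ∑ y, qy K y * Real.log (qy K y) := by
      rw [Finset.sum_comm]
      refine Finset.sum_congr rfl fun x _ => ?_
      rw [← Finset.sum_mul, ← hqy]
    have a2 : ∑ c, ∑ y, q K c y * Real.log 2 = Real.log 2 := by
      simp_rw [← Finset.sum_mul, hqc]; simp
    simp only [mul_add, mul_sub, Finset.sum_add_distrib, Finset.sum_sub_distrib]
    rw [a1, a2]
    simp_rw [hqc, ← hqy]
    simp
    ring
  simp_rw [eL]
  refine hfin.trans (le_of_eq ?_)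
  have b1 : ∑ v, (∑ x, p v x) * Real.log (∑ x, p v x) = - (N * Real.log 2) := by
    simp_rw [hm]
    rw [← Finset.sum_mul, hcard, Real.log_pow]
    simp
  rw [b1]
  simp_rw [← hpx]
  ring

lemma measure_split {Ω : Type*} [MeasurableSpace Ω] (μ : Measure Ω) [IsFiniteMeasure μ]
    {W : Type*} [Fintype W] (Z : Ω → W) (hZ : ∀ w, MeasurableSet (Z ⁻¹' {w})) (A : Set Ω)
    (hA : MeasurableSet A) :
    (μ A).toReal = ∑ w, (μ (A ∩ Z ⁻¹' {w})).toReal := by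
  classical
  rw [← ENNReal.toReal_sum (fun _ _ => measure_ne_top _ _)]
  congr 1
  rw [← measure_biUnion_finset]
  · congr 1; ext ω; simp
  · intro i _ j _ hij
    rw [Function.onFun, Set.disjoint_left]
    rintro ω ⟨_, h1⟩ ⟨_, h2⟩
    exact hij (h1.symm.trans h2)
  · exact fun w _ => hA.inter (hZ w)

lemma mutualInfo_eq {Ω : Type*} [MeasurableSpace Ω] (ν : Measure Ω) [IsFiniteMeasure ν]
    {S T : Type*} [Fintype S] [Fintype T] (X : Ω → S) (Y : Ω → T)
    (hX : ∀ s, MeasurableSet (X ⁻¹' {s})) (hY : ∀ s, MeasurableSet (Y ⁻¹' {s}))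
    (j : S → T → ℝ) (hj : ∀ s t, (ν (X ⁻¹' {s} ∩ Y ⁻¹' {t})).toReal = j s t) :
    mutualInfo ν X Y = (∑ s, ∑ t, j s t * Real.log (j s t)
        - ∑ s, (∑ t, j s t) * Real.log (∑ t, j s t)
        - ∑ t, (∑ s, j s t) * Real.log (∑ s, j s t)) / Real.log 2 := by
  have h1 : ∀ s, (ν (X ⁻¹' {s})).toReal = ∑ t, j s t := fun s => by
    simp_rw [← hj]; exact measure_split ν Y hY _ (hX s)
  have h2 : ∀ t, (ν (Y ⁻¹' {t})).toReal = ∑ s, j s t := fun t => by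
    
    simp_rw [← hj]
    rw [measure_split ν X hX _ (hY t)]
    exact Finset.sum_congr rfl fun s _ => by rw [Set.inter_comm]
  have h3 : ∀ z : S × T, (ν ((fun ω => (X ω, Y ω)) ⁻¹' {z})).toReal = j z.1 z.2 := fun z => by
    rw [← hj]; congr 2; ext ω; simp [Prod.ext_iff]
  unfold mutualInfo entropy
  simp_rw [h1, h2, h3, Fintype.sum_prod_type, Real.logb, ← mul_div_assoc, ← Finset.sum_div]
  ring

/-- **Neural-IC embedding inequality.** For independent unbiased database bits
`a`, finitely-valued bottleneck `H` and decoder-side resource `B`, a uniform query `b`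
independent of `(a, H, B)`, local decoder noise `R` independent of `(a, H, B, b)`, and output
`β = Dec(H, B, b, R)`, the Neural-RAC score satisfies
`Σ_K I(a_K : β | b = K) ≤ I(a : (H, B))`. -/
theorem neural_ic_embedding
    {Ω : Type*} [MeasurableSpace Ω] (μ : Measure Ω) [IsProbabilityMeasure μ]
    (N : ℕ) (hN : 0 < N)
    {S T U : Type*} [Fintype S] [Fintype T] [Fintype U]
    [MeasurableSpace S] [MeasurableSingletonClass S]
    [MeasurableSpace T] [MeasurableSingletonClass T]
    [MeasurableSpace U] [MeasurableSingletonClass U]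
    (a : Fin N → Ω → Bool) (H : Ω → S) (B : Ω → T) (b : Ω → Fin N) (R : Ω → U)
    (Dec : S → T → Fin N → U → Bool) (β : Ω → Bool)
    (ha : ∀ i, Measurable (a i)) (hH : Measurable H) (hB : Measurable B)
    (hb : Measurable b) (hR : Measurable R)
    (hβ : β = fun ω => Dec (H ω) (B ω) (b ω) (R ω))
    (hiid : ∀ v : Fin N → Bool,
      μ {ω | ∀ i, a i ω = v i} = ((1 : ℝ≥0∞) / 2) ^ N)
    (hbindep : ∀ (v : Fin N → Bool) (s : S) (t : T) (K : Fin N),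
      μ {ω | (∀ i, a i ω = v i) ∧ H ω = s ∧ B ω = t ∧ b ω = K}
        = ((N : ℝ≥0∞))⁻¹ * μ {ω | (∀ i, a i ω = v i) ∧ H ω = s ∧ B ω = t})
    (hRindep : ∀ (v : Fin N → Bool) (s : S) (t : T) (K : Fin N) (u : U),
      μ {ω | (∀ i, a i ω = v i) ∧ H ω = s ∧ B ω = t ∧ b ω = K ∧ R ω = u}
        = μ {ω | R ω = u}
            * μ {ω | (∀ i, a i ω = v i) ∧ H ω = s ∧ B ω = t ∧ b ω = K}) :
    ∑ K : Fin N, mutualInfo (μ[|b ⁻¹' {K}]) (a K) β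
      ≤ mutualInfo μ (fun ω => (fun i => a i ω)) (fun ω => (H ω, B ω)) := by
    classical
  have hNr : (N : ℝ) ≠ 0 := by exact_mod_cast hN.ne'
  have ha' : Measurable (fun ω => (fun i => a i ω)) := measurable_pi_iff.2 ha
  have hX : Measurable (fun ω => (H ω, B ω)) := hH.prodMk hB
  have hβm : Measurable β := by
    rw [hβ]
    exact (measurable_of_finite (fun z : S × T × Fin N × U => Dec z.1 z.2.1 z.2.2.1 z.2.2.2)).comp
      (hH.prodMk (hB.prodMk (hb.prodMk hR)))
  obtain ⟨p, hpdef⟩ : ∃ p : (Fin N → Bool) → S × T → ℝ, ∀ v x, p v x =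
      (μ ((fun ω => (fun i => a i ω)) ⁻¹' {v} ∩ (fun ω => (H ω, B ω)) ⁻¹' {x})).toReal :=
    ⟨_, fun _ _ => rfl⟩
  obtain ⟨r, hr⟩ : ∃ r : U → ℝ, ∀ u, r u = (μ (R ⁻¹' {u})).toReal := ⟨_, fun _ => rfl⟩
  have hp0 : ∀ v x, 0 ≤ p v x := fun v x => by rw [hpdef]; exact ENNReal.toReal_nonneg
  have hm : ∀ v, ∑ x, p v x = (1 / 2 : ℝ) ^ N := by
    intro v
    simp_rw [hpdef]
    rw [← measure_split μ _ (fun x => hX (measurableSet_singleton x)) _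
      (ha' (measurableSet_singleton v))]
    have h := hiid v
    have e : (fun ω => (fun i => a i ω)) ⁻¹' {v} = {ω | ∀ i, a i ω = v i} := by
      ext ω; simp [funext_iff]
    rw [e, h]; simp
  have hr1 : ∑ u, r u = 1 := by
    have := measure_split μ R (fun u => hR (measurableSet_singleton u)) Set.univ MeasurableSet.univ
    simp only [Set.univ_inter, measure_univ, ENNReal.toReal_one] at this
    simp_rw [hr]; exact this.symm
  have hr0 : ∀ u, 0 ≤ r u := fun u => by rw [hr]; exact ENNReal.toReal_nonneg
  -- the joint law
  let Z : Ω → (Fin N → Bool) × (S × T) × U := fun ω => ((fun i => a i ω), (H ω, B ω), R ω)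
  have hZ : Measurable Z := ha'.prodMk (hX.prodMk hR)
  have hjoint : ∀ K v x u, (μ (b ⁻¹' {K} ∩ Z ⁻¹' {(v, x, u)})).toReal
      = (N : ℝ)⁻¹ * (p v x * r u) := by
    rintro K v ⟨s, t⟩ u
    have e1 : b ⁻¹' {K} ∩ Z ⁻¹' {(v, (s, t), u)}
        = {ω | (∀ i, a i ω = v i) ∧ H ω = s ∧ B ω = t ∧ b ω = K ∧ R ω = u} := by
      ext ω; simp [Z, funext_iff]; tauto
    have e2 : (fun ω => (fun i => a i ω)) ⁻¹' {v} ∩ (fun ω => (H ω, B ω)) ⁻¹' {(s, t)}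
        = {ω | (∀ i, a i ω = v i) ∧ H ω = s ∧ B ω = t} := by
      ext ω; simp [funext_iff]
    have e3 : R ⁻¹' {u} = {ω | R ω = u} := by ext ω; simp
    rw [e1, hRindep, hbindep, hpdef, hr, e2, e3]
    simp only [ENNReal.toReal_mul, ENNReal.toReal_inv, ENNReal.toReal_natCast]
    ring
  have hptot : ∑ v, ∑ x, p v x = 1 := by simp_rw [hm]; simp
  have hevent : ∀ K (φ : (Fin N → Bool) × (S × T) × U → Prop),
      (μ (b ⁻¹' {K} ∩ {ω | φ (Z ω)})).toReal
        = (N : ℝ)⁻¹ * ∑ v, ∑ x, ∑ u, if φ (v, x, u) then p v x * r u else 0 := by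
    intro K φ
    have hφ : MeasurableSet {ω | φ (Z ω)} := hZ (Set.toFinite {z | φ z}).measurableSet
    rw [measure_split μ Z (fun z => hZ (measurableSet_singleton z)) _
      ((hb (measurableSet_singleton K)).inter hφ)]
    simp_rw [Fintype.sum_prod_type, Finset.mul_sum]
    refine Finset.sum_congr rfl fun v _ => Finset.sum_congr rfl fun s _ =>
      Finset.sum_congr rfl fun t _ => Finset.sum_congr rfl fun u _ => ?_
    split_ifs with h
    · rw [← hjoint K]
      congr 2
      ext ω
      simp only [Set.mem_inter_iff, Set.mem_preimage, Set.mem_singleton_iff, Set.mem_ofPred_eq]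
      constructor
      · rintro ⟨⟨h1, h2⟩, h3⟩; exact ⟨h1, h3⟩
      · rintro ⟨h1, h3⟩; exact ⟨⟨h1, h3 ▸ h⟩, h3⟩
    · have : b ⁻¹' {K} ∩ {ω | φ (Z ω)} ∩ Z ⁻¹' {(v, (s, t), u)} = ∅ := by
        ext ω
        simp only [Set.mem_inter_iff, Set.mem_preimage, Set.mem_singleton_iff, Set.mem_ofPred_eq,
          Set.mem_empty_iff_false, iff_false]
        rintro ⟨⟨h1, h2⟩, h3⟩; exact h (h3 ▸ h2)
      rw [this]; simp
  have hbK : ∀ K, (μ (b ⁻¹' {K})).toReal = (N : ℝ)⁻¹ := by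
    intro K
    have h := hevent K (fun _ => True)
    simp only [Set.ofPred_true, Set.inter_univ, if_true] at h
    rw [h]
    simp_rw [← Finset.mul_sum, hr1, mul_one, hptot]
    simp
  have hcond : ∀ K (φ : (Fin N → Bool) × (S × T) × U → Prop),
      (μ[|b ⁻¹' {K}] {ω | φ (Z ω)}).toReal
        = ∑ v, ∑ x, ∑ u, if φ (v, x, u) then p v x * r u else 0 := by
    intro K φ
    rw [cond_apply (hb (measurableSet_singleton K)), ENNReal.toReal_mul, ENNReal.toReal_inv, hbK,
      hevent, inv_inv, mul_inv_cancel_left₀ hNr]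
  let w : Fin N → S × T → Bool → ℝ := fun K x y => ∑ u, if Dec x.1 x.2 K u = y then r u else 0
  let q : Fin N → Bool → Bool → ℝ := fun K c y =>
    ∑ v, ∑ x, if v K = c then p v x * w K x y else 0
  have hw0 : ∀ K x y, 0 ≤ w K x y := fun K x y => Finset.sum_nonneg fun u _ => by
    split_ifs
    · exact hr0 u
    · exact le_rfl
  have hw1 : ∀ K x, ∑ y, w K x y = 1 := by
    intro K x
    simp only [w]
    rw [Finset.sum_comm, ← hr1]
    refine Finset.sum_congr rfl fun u _ => ?_
    rw [Finset.sum_ite_eq]; simp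
  have hjq : ∀ K c y, (μ[|b ⁻¹' {K}] (a K ⁻¹' {c} ∩ β ⁻¹' {y})).toReal = q K c y := by
    intro K c y
    have e0 := hcond K (fun z => z.1 K = c ∧ Dec z.2.1.1 z.2.1.2 K z.2.2 = y)
    have e1 : (μ[|b ⁻¹' {K}] (a K ⁻¹' {c} ∩ β ⁻¹' {y}))
        = μ[|b ⁻¹' {K}] {ω | (fun z : (Fin N → Bool) × (S × T) × U =>
          z.1 K = c ∧ Dec z.2.1.1 z.2.1.2 K z.2.2 = y) (Z ω)} := by
      rw [cond_apply (hb (measurableSet_singleton K)), cond_apply (hb (measurableSet_singleton K))]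
      congr 2
      ext ω
      simp only [Set.mem_inter_iff, Set.mem_preimage, Set.mem_singleton_iff, Set.mem_ofPred_eq, hβ, Z]
      constructor
      · rintro ⟨h1, h2, h3⟩; subst h1; exact ⟨rfl, h2, h3⟩
      · rintro ⟨h1, h2, h3⟩; subst h1; exact ⟨rfl, h2, h3⟩
    rw [e1, e0]
    simp only [q, w]
    refine Finset.sum_congr rfl fun v _ => Finset.sum_congr rfl fun x _ => ?_
    by_cases h : v K = c
    · simp [h, Finset.mul_sum]
    · simp [h]
  have hqc : ∀ K c, ∑ y, q K c y = 1 / 2 := by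
    intro K c
    have e : ∀ c, ∑ y, q K c y = ∑ v : Fin N → Bool, if v K = c then (1 / 2 : ℝ) ^ N else 0 := by
      intro c
      simp only [q]
      rw [Finset.sum_comm]
      refine Finset.sum_congr rfl fun v _ => ?_
      rw [Finset.sum_comm, ← hm v]
      by_cases h : v K = c
      · simp only [h, if_true, ← Finset.mul_sum, hw1, mul_one]
      · simp [h]
    have hflip : ∑ y, q K c y = ∑ y, q K (!c) y := by
      rw [e, e]
      refine Fintype.sum_equiv (Equiv.piCongrRight fun _ => Equiv.boolNot) _ _ fun v => ?_
      simp
    have htot : ∑ y, q K c y + ∑ y, q K (!c) y = 1 := by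
      rw [e, e, ← Finset.sum_add_distrib]
      have h1 : ∑ v : Fin N → Bool, ((1 / 2 : ℝ) ^ N) = 1 := by simp
      rw [← h1]
      refine Finset.sum_congr rfl fun v _ => ?_
      cases v K <;> cases c <;> simp
    linarith
  have hcore := core_ineq N p hp0 hm w hw0 hw1 q (fun _ _ _ => rfl) hqc
  rw [mutualInfo_eq μ _ _ (fun s => ha' (measurableSet_singleton s))
    (fun s => hX (measurableSet_singleton s)) p (fun s t => (hpdef s t).symm)]
  have hK : ∀ K, mutualInfo (μ[|b ⁻¹' {K}]) (a K) β = _ := fun K =>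
    mutualInfo_eq (μ[|b ⁻¹' {K}]) (a K) β (fun s => ha K (measurableSet_singleton s))
      (fun s => hβm (measurableSet_singleton s)) (q K) (hjq K)
  simp_rw [hK, ← Finset.sum_div]
  exact div_le_div_of_nonneg_right hcore (Real.log_nonneg (by norm_num))
end

section
/- Consider a classical query-separated protocol with a hard m-bit bottleneck: the database a = (a₀,…,a_{N−1}) is uniform on {0,1}^N; (R_A, R_B) is shared randomness independent of a; h = Enc(a, R_A) ∈ {0,1}^m; b is uniform on {0,…,N−1} independent of (a, R_A, R_B); and β = Dec(h, R_B, b) ∈ {0,1}. With P_K := Pr[β = a_K | b = K], the per-query success probabilities satisfy N − Σ_{K=0}^{N−1} h(P_K) ≤ m. -/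
open MeasureTheory ProbabilityTheory
open scoped ENNReal

open Classical in
/-- Finite combinatorial core: Gibbs inequality against the product code distribution. -/
lemma cap_core (N m : ℕ) {R : Type*} [Fintype R] (p : R → ℝ) (hp : ∀ r, 0 ≤ p r)
    (hp1 : ∑ r, p r = 1) (g : (Fin N → Bool) → R → (Fin m → Bool))
    (D : (Fin m → Bool) → R → Fin N → Bool) (P : Fin N → ℝ)
    (hP : ∀ K, P K = ∑ z : (Fin N → Bool) × R,
      if D (g z.1 z.2) z.2 K = z.1 K then (1 / 2 : ℝ) ^ N * p z.2 else 0) :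
    (N : ℝ) - ∑ K, binEnt (P K) ≤ m := by
  set w : (Fin N → Bool) × R → ℝ := fun z => (1 / 2 : ℝ) ^ N * p z.2 with hw
  have hw0 : ∀ z, 0 ≤ w z := fun z => mul_nonneg (by positivity) (hp _)
  have hw1 : ∑ z, w z = 1 := by
    rw [Fintype.sum_prod_type]
    simp only [hw, ← Finset.mul_sum, hp1]
    simp
  have hQ : ∀ K, 1 - P K = ∑ z : (Fin N → Bool) × R,
      if D (g z.1 z.2) z.2 K = z.1 K then 0 else w z := by
    intro K
    rw [hP]
    nth_rewrite 1 [← hw1]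
    rw [← Finset.sum_sub_distrib]
    refine Finset.sum_congr rfl fun z _ => ?_
    split_ifs <;> simp [hw]
  have hP0 : ∀ K, 0 ≤ P K := by
    intro K
    rw [hP]
    refine Finset.sum_nonneg fun z _ => ?_
    split_ifs
    · exact hw0 z
    · exact le_rfl
  have hQ0 : ∀ K, 0 ≤ 1 - P K := by
    intro K
    rw [hQ]
    refine Finset.sum_nonneg fun z _ => ?_
    split_ifs
    · exact le_rfl
    · exact hw0 z
  let q : Fin N → Bool → Bool → ℝ := fun K c d => if c = d then P K else 1 - P K
  have hq0 : ∀ K c d, 0 ≤ q K c d := by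
    intro K c d
    simp only [q]
    split_ifs
    · exact hP0 K
    · exact hQ0 K
  have hqs : ∀ K c, ∑ d, q K c d = 1 := by
    intro K c
    cases c <;> simp [q]
  let L : (Fin N → Bool) × R → Fin N → ℝ := fun z K => q K (D (g z.1 z.2) z.2 K) (z.1 K)
  let x : (Fin N → Bool) × R → ℝ := fun z => ∏ K, L z K
  have hLpos : ∀ z, w z ≠ 0 → ∀ K, 0 < L z K := by
    intro z hz K
    have hwz : 0 < w z := lt_of_le_of_ne (hw0 z) (Ne.symm hz)
    by_cases hc : D (g z.1 z.2) z.2 K = z.1 K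
    · have : w z ≤ P K := by
        rw [hP]
        have := Finset.single_le_sum (f := fun z : (Fin N → Bool) × R =>
          if D (g z.1 z.2) z.2 K = z.1 K then w z else 0) (s := Finset.univ)
          (fun z _ => by
            split_ifs
            · exact hw0 z
            · exact le_rfl) (Finset.mem_univ z)
        simpa only [hc, if_true] using this
      simp only [L, q, hc, if_true]
      linarith
    · have : w z ≤ 1 - P K := by
        rw [hQ]
        have := Finset.single_le_sum (f := fun z : (Fin N → Bool) × R =>
          if D (g z.1 z.2) z.2 K = z.1 K then 0 else w z) (s := Finset.univ)
          (fun z _ => by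
            split_ifs
            · exact le_rfl
            · exact hw0 z) (Finset.mem_univ z)
        simpa [hc] using this
      simp only [L, q, hc, if_false]
      linarith
  -- expectation of the product
  have hx : ∀ r, ∑ v, x (v, r) ≤ 2 ^ m := by
    intro r
    calc ∑ v, x (v, r) ≤ ∑ v : Fin N → Bool, ∑ h : Fin m → Bool, ∏ K, q K (D h r K) (v K) := by
          refine Finset.sum_le_sum fun v _ => ?_
          exact Finset.single_le_sum (f := fun h : Fin m → Bool => ∏ K, q K (D h r K) (v K))
            (fun h _ => Finset.prod_nonneg fun K _ => hq0 _ _ _) (Finset.mem_univ (g v r))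
      _ = ∑ h : Fin m → Bool, ∑ v : Fin N → Bool, ∏ K, q K (D h r K) (v K) := Finset.sum_comm
      _ = ∑ h : Fin m → Bool, (1 : ℝ) := by
          refine Finset.sum_congr rfl fun h _ => ?_
          rw [← Fintype.prod_sum]
          simp only [hqs, Finset.prod_const_one]
      _ = 2 ^ m := by simp
  have hEx : ∑ z, w z * x z ≤ (1 / 2 : ℝ) ^ N * 2 ^ m := by
    rw [Fintype.sum_prod_type_right]
    calc ∑ r, ∑ v, w (v, r) * x (v, r) = ∑ r, (1 / 2 : ℝ) ^ N * p r * ∑ v, x (v, r) := by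
          simp only [hw, Finset.mul_sum]
      _ ≤ ∑ r, (1 / 2 : ℝ) ^ N * p r * 2 ^ m :=
          Finset.sum_le_sum fun r _ => mul_le_mul_of_nonneg_left (hx r)
            (mul_nonneg (by positivity) (hp r))
      _ = (1 / 2 : ℝ) ^ N * 2 ^ m := by
          rw [← Finset.sum_mul, ← Finset.mul_sum, hp1, mul_one]
  set c : ℝ := (1 / 2 : ℝ) ^ N * 2 ^ m with hc
  have hcpos : 0 < c := by positivity
  have hlogc : Real.log c = (m - N) * Real.log 2 := by
    rw [hc, Real.log_mul (by positivity) (by positivity), Real.log_pow, Real.log_pow, one_div,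
      Real.log_inv]
    ring
  have hpt : ∀ z, w z * ∑ K, Real.log (L z K) ≤ w z * x z / c + w z * (Real.log c - 1) := by
    intro z
    by_cases hz : w z = 0
    · simp [hz]
    · have hpos := hLpos z hz
      have hxpos : 0 < x z := Finset.prod_pos fun K _ => hpos K
      have h1 : ∑ K, Real.log (L z K) = Real.log (x z) :=
        (Real.log_prod (fun K _ => (hpos K).ne')).symm
      have h2 := Real.log_le_sub_one_of_pos (div_pos hxpos hcpos)
      rw [Real.log_div hxpos.ne' hcpos.ne'] at h2
      rw [h1, mul_div_assoc, ← mul_add]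
      exact mul_le_mul_of_nonneg_left (by linarith) (hw0 z)
  have hsum : ∑ z, w z * ∑ K, Real.log (L z K) ≤ Real.log c := by
    calc _ ≤ ∑ z, (w z * x z / c + w z * (Real.log c - 1)) := Finset.sum_le_sum fun z _ => hpt z
      _ = (∑ z, w z * x z) / c + (Real.log c - 1) := by
          rw [Finset.sum_add_distrib, ← Finset.sum_div, ← Finset.sum_mul, hw1, one_mul]
      _ ≤ 1 + (Real.log c - 1) := by
          gcongr
          exact (div_le_one hcpos).2 hEx
      _ = Real.log c := by ring
  have hleft : ∑ z, w z * ∑ K, Real.log (L z K) = -(∑ K, binEnt (P K)) * Real.log 2 := by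
    simp only [Finset.mul_sum]
    rw [Finset.sum_comm, ← Finset.sum_neg_distrib, Finset.sum_mul]
    refine Finset.sum_congr rfl fun K _ => ?_
    have hb : -binEnt (P K) * Real.log 2
        = P K * Real.log (P K) + (1 - P K) * Real.log (1 - P K) := by
      have : Real.log 2 ≠ 0 := (Real.log_pos one_lt_two).ne'
      simp only [binEnt, Real.logb]
      field_simp
      ring
    rw [hb]
    have e1 : P K * Real.log (P K) = ∑ z : (Fin N → Bool) × R,
      (if D (g z.1 z.2) z.2 K = z.1 K then w z else 0) * Real.log (P K) := by
      rw [← Finset.sum_mul, ← hP]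
    have e2 : (1 - P K) * Real.log (1 - P K) = ∑ z : (Fin N → Bool) × R,
      (if D (g z.1 z.2) z.2 K = z.1 K then 0 else w z) * Real.log (1 - P K) := by
      rw [← Finset.sum_mul, ← hQ]
    rw [e1, e2, ← Finset.sum_add_distrib]
    refine Finset.sum_congr rfl fun z _ => ?_
    simp only [L, q]
    split_ifs <;> simp
  rw [hleft, hlogc] at hsum
  have := le_of_mul_le_mul_right hsum (Real.log_pos one_lt_two)
  linarith

/-- **capacity–accuracy tradeoff.** For a classical query-separated protocol
with a hard `m`-bit bottleneck `h = Enc(a, R_A)`, uniform database `a` on `{0,1}^N`, shared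
randomness `(R_A, R_B)` independent of `a`, uniform query `b` independent of everything, and
output `β = Dec(h, R_B, b)`, the per-query success probabilities `P_K = Pr[β = a_K | b = K]`
satisfy `N - Σ_K h(P_K) ≤ m`. -/
theorem capacity_accuracy_tradeoff
    {Ω : Type*} [MeasurableSpace Ω] (μ : Measure Ω) [IsProbabilityMeasure μ]
    (N m : ℕ) (hN : 0 < N)
    {S T : Type*} [Fintype S] [Fintype T]
    [MeasurableSpace S] [MeasurableSingletonClass S]
    [MeasurableSpace T] [MeasurableSingletonClass T]
    (a : Fin N → Ω → Bool) (RA : Ω → S) (RB : Ω → T) (b : Ω → Fin N)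
    (Enc : (Fin N → Bool) → S → (Fin m → Bool))
    (Dec : (Fin m → Bool) → T → Fin N → Bool)
    (β : Ω → Bool)
    (ha : ∀ i, Measurable (a i)) (hRA : Measurable RA) (hRB : Measurable RB)
    (hb : Measurable b)
    (hβ : β = fun ω => Dec (Enc (fun i => a i ω) (RA ω)) (RB ω) (b ω))
    (hjoint : ∀ (v : Fin N → Bool) (K : Fin N) (s : S) (t : T),
      μ {ω | (∀ i, a i ω = v i) ∧ b ω = K ∧ RA ω = s ∧ RB ω = t}
        = ((1 : ℝ≥0∞) / 2) ^ N * ((N : ℝ≥0∞))⁻¹ * μ {ω | RA ω = s ∧ RB ω = t}) :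
    (N : ℝ) - ∑ K : Fin N, binEnt ((μ[|b ⁻¹' {K}] {ω | β ω = a K ω}).toReal) ≤ (m : ℝ) := by
  classical
  let X : Ω → (Fin N → Bool) × (S × T) := fun ω => (fun i => a i ω, RA ω, RB ω)
  let p : S × T → ℝ := fun r => μ.real {ω | RA ω = r.1 ∧ RB ω = r.2}
  have hmA : ∀ s, MeasurableSet {ω | RA ω = s} := fun s => hRA (measurableSet_singleton s)
  have hmB : ∀ t, MeasurableSet {ω | RB ω = t} := fun t => hRB (measurableSet_singleton t)
  have hmb : ∀ K, MeasurableSet (b ⁻¹' {K}) := fun K => hb (measurableSet_singleton K)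
  have hmR : ∀ r : S × T, MeasurableSet {ω | RA ω = r.1 ∧ RB ω = r.2} :=
    fun r => (hmA r.1).inter (hmB r.2)
  have hmX : ∀ z, MeasurableSet (X ⁻¹' {z}) := by
    rintro ⟨v, s, t⟩
    have : X ⁻¹' {(v, s, t)} = (⋂ i, a i ⁻¹' {v i}) ∩ {ω | RA ω = s ∧ RB ω = t} := by
      ext ω
      simp [X, funext_iff]
    rw [this]
    exact (MeasurableSet.iInter fun i => ha i (measurableSet_singleton _)).inter (hmR (s, t))
  have hp1 : ∑ r, p r = 1 := by
    have h := sum_measureReal_preimage_singleton (μ := μ) (f := fun ω => (RA ω, RB ω))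
      Finset.univ (fun r _ => by
        have : (fun ω => (RA ω, RB ω)) ⁻¹' {r} = {ω | RA ω = r.1 ∧ RB ω = r.2} := by
          ext ω
          simp [Prod.ext_iff]
        rw [this]
        exact hmR r)
    have h2 : ∀ r : S × T, (fun ω => (RA ω, RB ω)) ⁻¹' {r} = {ω | RA ω = r.1 ∧ RB ω = r.2} := by
      intro r
      ext ω
      simp [Prod.ext_iff]
    simp only [h2] at h
    simpa [p] using h
  have hj : ∀ z K, μ.real (X ⁻¹' {z} ∩ b ⁻¹' {K}) = (N : ℝ)⁻¹ * ((1 / 2 : ℝ) ^ N * p z.2) := by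
    rintro ⟨v, s, t⟩ K
    have : X ⁻¹' {(v, s, t)} ∩ b ⁻¹' {K}
        = {ω | (∀ i, a i ω = v i) ∧ b ω = K ∧ RA ω = s ∧ RB ω = t} := by
      ext ω
      simp [X, funext_iff]
      tauto
    rw [this, measureReal_def, hjoint]
    simp [p, measureReal_def, ENNReal.toReal_mul]
    ring
  have hkey : ∀ K (F : (Fin N → Bool) × (S × T) → Prop),
      μ.real (b ⁻¹' {K} ∩ {ω | F (X ω)})
        = (N : ℝ)⁻¹ * ∑ z, if F z then (1 / 2 : ℝ) ^ N * p z.2 else 0 := by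
    intro K F
    have h := sum_measureReal_preimage_singleton (μ := μ.restrict (b ⁻¹' {K})) (f := X)
      (Finset.univ.filter F) (fun z _ => hmX z)
    have hmF : MeasurableSet (X ⁻¹' (Finset.univ.filter F : Finset _)) := by
      rw [← Set.biUnion_preimage_singleton]
      exact Finset.measurableSet_biUnion _ fun z _ => hmX z
    rw [measureReal_restrict_apply hmF] at h
    have h3 : X ⁻¹' (Finset.univ.filter F : Finset _) ∩ b ⁻¹' {K}
        = b ⁻¹' {K} ∩ {ω | F (X ω)} := by
      ext ω
      simp [and_comm]
    rw [h3] at h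
    rw [← h, Finset.mul_sum, Finset.sum_filter]
    refine Finset.sum_congr rfl fun z _ => ?_
    split_ifs
    · rw [measureReal_restrict_apply (hmX z), hj]
    · simp
  have hN' : (N : ℝ) ≠ 0 := by positivity
  have hbK : ∀ K, μ.real (b ⁻¹' {K}) = (N : ℝ)⁻¹ := by
    intro K
    have h := hkey K (fun _ => True)
    simp only [Set.setOf_true, Set.inter_univ, if_true] at h
    rw [h, Fintype.sum_prod_type]
    simp only [← Finset.mul_sum, hp1]
    simp
  refine cap_core N m p (fun r => measureReal_nonneg) hp1 (fun v r => Enc v r.1)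
    (fun h r K => Dec h r.2 K) _ ?_
  intro K
  have h := hkey K (fun z => Dec (Enc z.1 z.2.1) z.2.2 K = z.1 K)
  have hset : b ⁻¹' {K} ∩ {ω | β ω = a K ω}
      = b ⁻¹' {K} ∩ {ω | Dec (Enc (X ω).1 (X ω).2.1) (X ω).2.2 K = (X ω).1 K} := by
    ext ω
    simp only [Set.mem_inter_iff, Set.mem_preimage, Set.mem_singleton_iff, Set.mem_setOf_eq, hβ, X]
    constructor
    · rintro ⟨h1, h2⟩
      rw [h1] at h2
      exact ⟨h1, h2⟩
    · rintro ⟨h1, h2⟩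
      rw [← h1] at h2
      exact ⟨h1, by rw [h2, h1]⟩
  rw [cond_apply (hmb K), ENNReal.toReal_mul, ENNReal.toReal_inv, ← measureReal_def,
    ← measureReal_def, hbK, hset, h, inv_inv, ← mul_assoc, mul_inv_cancel₀ hN', one_mul]
  refine Finset.sum_congr rfl fun z _ => ?_
  congr
end

section
/- Let X = (X₁,…,X_N) be uniformly distributed on {−1,+1}^N. For a function f : {−1,+1}^N → {−1,+1}, define its average one-bit RAC success P_avg(f) := 1/2 + (1/(2N)) Σ_{i=1}^N |E[X_i f(X)]|. Then the maximum of P_avg(f) over all f equals 1/2 + 2^{−N} · C(N−1, ⌊(N−1)/2⌋), and it is attained by the majority function (with any fixed tie-breaking rule when N is even). Equivalently, the optimal classical one-bit average success probability for random access to N independent unbiased bits is 1/2 + 2^{−N} · C(N−1, ⌊(N−1)/2⌋). -/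
/-- Identify `{-1,+1}` with `Bool`: `true ↦ +1`, `false ↦ -1`. -/
def toSign (x : Bool) : ℝ := if x then 1 else -1

/-- The average one-bit RAC success probability of an encoder `f : {-1,+1}^N → {-1,+1}`:
`P_avg(f) = 1/2 + (1/(2N)) Σ_i |E[X_i f(X)]|`, where `X` is uniform on `{-1,+1}^N`, so that
`E[X_i f(X)] = 2^{-N} Σ_x x_i f(x)`. -/
noncomputable def Pavg (N : ℕ) (f : (Fin N → Bool) → Bool) : ℝ :=
  1 / 2 + (1 / (2 * N)) * ∑ i : Fin N,
    |(∑ x : Fin N → Bool, toSign (x i) * toSign (f x)) / 2 ^ N|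

/-- `f` is a majority function: it outputs the sign of `Σ_i x_i` whenever that sum is
nonzero (any fixed tie-breaking convention is allowed when `N` is even). -/
def IsMajority (N : ℕ) (f : (Fin N → Bool) → Bool) : Prop :=
  ∀ x : Fin N → Bool,
    (0 < ∑ i : Fin N, toSign (x i) → f x = true) ∧
    (∑ i : Fin N, toSign (x i) < 0 → f x = false)


lemma toSign_sum_eq (N : ℕ) (x : Fin N → Bool) :
    ∑ i, toSign (x i) = 2 * ((Finset.univ.filter (fun i => x i = true)).card : ℝ) - N := by
  have h : ∀ i, toSign (x i) = 2 * (if x i = true then (1:ℝ) else 0) - 1 := by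
    intro i; unfold toSign; split_ifs <;> norm_num
  simp only [h, Finset.sum_sub_distrib, ← Finset.mul_sum, Finset.sum_boole]
  simp

lemma sum_card_eq (N : ℕ) (h : ℕ → ℝ) :
    ∑ x : Fin N → Bool, h (Finset.univ.filter (fun i => x i = true)).card
      = ∑ m ∈ Finset.range (N + 1), (N.choose m : ℝ) * h m := by
  have h1 := Finset.sum_powerset_apply_card h (x := (Finset.univ : Finset (Fin N)))
  simp only [Finset.card_univ, Fintype.card_fin, nsmul_eq_mul, Finset.powerset_univ] at h1
  rw [← h1]
  refine Finset.sum_bij' (fun x _ => Finset.univ.filter (fun i => x i = true))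
    (fun s _ => fun i => decide (i ∈ s)) ?_ ?_ ?_ ?_ ?_
  · simp
  · simp
  · intro x _; ext i; simp
  · intro s _; ext i; simp
  · intro x _; rfl

lemma zero_count (N : ℕ) :
    (∑ x : Fin N → Bool, if ∑ i, toSign (x i) = 0 then (1:ℝ) else 0)
      = if Even N then (N.choose (N / 2) : ℝ) else 0 := by
  have h := sum_card_eq N (fun m => if (2 * (m:ℝ) - N) = 0 then 1 else 0)
  simp only [toSign_sum_eq]
  rw [h]
  have e : ∀ m : ℕ, (2 * (m:ℝ) - N = 0) ↔ 2 * m = N := by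
    intro m; rw [sub_eq_zero]; exact_mod_cast Iff.rfl
  simp only [e]
  split_ifs with hE
  · obtain ⟨k, rfl⟩ := hE
    rw [Finset.sum_eq_single ((k + k) / 2)]
    · rw [if_pos (by omega)]; simp
    · intro b _ hb; rw [if_neg (by omega)]; simp
    · intro hb; simp at hb; omega
  · apply Finset.sum_eq_zero
    intro b _
    rw [if_neg, mul_zero]
    rintro rfl
    simp at hE

lemma abs_step (N : ℕ) (x : Fin N → Bool) :
    |1 + ∑ i, toSign (x i)| + |-1 + ∑ i, toSign (x i)|
      = 2 * |∑ i, toSign (x i)| + 2 * (if ∑ i, toSign (x i) = 0 then (1:ℝ) else 0) := by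
  have hz : ∃ z : ℤ, ∑ i, toSign (x i) = z := by
    refine ⟨2 * ((Finset.univ.filter (fun i => x i = true)).card : ℤ) - N, ?_⟩
    rw [toSign_sum_eq]; push_cast; rfl
  obtain ⟨z, hz⟩ := hz
  rw [hz]
  have : |1 + z| + |-1 + z| = 2 * |z| + 2 * (if z = 0 then (1:ℤ) else 0) := by
    split_ifs <;> grind
  have h2 : ((z:ℝ) = 0) ↔ z = 0 := by exact_mod_cast Iff.rfl
  simp only [h2]
  exact_mod_cast this

lemma abs_rec (N : ℕ) :
    ∑ x : Fin (N + 1) → Bool, |∑ i, toSign (x i)|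
      = 2 * ∑ x : Fin N → Bool, |∑ i, toSign (x i)|
        + 2 * (if Even N then (N.choose (N / 2) : ℝ) else 0) := by
  rw [← zero_count, Finset.mul_sum, Finset.mul_sum, ← Finset.sum_add_distrib,
    ← (Fin.consEquiv (fun _ : Fin (N + 1) => Bool)).sum_comp, Fintype.sum_prod_type,
    Fintype.sum_bool, ← Finset.sum_add_distrib]
  refine Finset.sum_congr rfl fun x _ => ?_
  rw [← abs_step]
  simp [Fin.consEquiv, Fin.sum_univ_succ, toSign]

lemma abs_odd (m : ℕ) :
    (∑ x : Fin (2 * m + 1) → Bool, |∑ i, toSign (x i)| = 2 * (2 * m + 1) * ((2 * m).choose m : ℝ))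
    ∧ (∑ x : Fin (2 * m + 2) → Bool, |∑ i, toSign (x i)|
      = 2 * (2 * m + 2) * ((2 * m + 1).choose m : ℝ)) := by
  have key : ∀ m : ℕ, ((m:ℝ) + 1) * ((2 * m + 1).choose m : ℝ)
      = (2 * m + 1) * ((2 * m).choose m : ℝ) := by
    intro m
    have h := Nat.add_one_mul_choose_eq (2 * m) m
    have h' : (2 * m + 1).choose (m + 1) = (2 * m + 1).choose m := Nat.choose_symm_half m
    rw [h'] at h
    have : (((2 * m + 1) * (2 * m).choose m : ℕ) : ℝ) = (((2 * m + 1).choose m * (m + 1) : ℕ) : ℝ) := by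
      rw [h]
    push_cast at this
    linarith
  have step : ∀ m : ℕ, (∑ x : Fin (2 * m + 1) → Bool, |∑ i, toSign (x i)|
      = 2 * (2 * m + 1) * ((2 * m).choose m : ℝ)) →
      (∑ x : Fin (2 * m + 2) → Bool, |∑ i, toSign (x i)|
      = 2 * (2 * m + 2) * ((2 * m + 1).choose m : ℝ)) := by
    intro m h
    rw [abs_rec (2 * m + 1), h, if_neg (by simp)]
    linarith [key m]
  induction m with
  | zero =>
    have : (∑ x : Fin (2 * 0 + 1) → Bool, |∑ i, toSign (x i)|
      = 2 * (2 * (0:ℕ) + 1) * ((2 * 0).choose 0 : ℝ)) := by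
      rw [abs_rec (2 * 0)]; simp
    exact ⟨this, step 0 this⟩
  | succ m ih =>
    have : (∑ x : Fin (2 * (m + 1) + 1) → Bool, |∑ i, toSign (x i)|
      = 2 * (2 * (m + 1 : ℕ) + 1) * ((2 * (m + 1)).choose (m + 1) : ℝ)) := by
      rw [abs_rec (2 * (m + 1)), if_pos (by simp)]
      have e := ih.2
      have e2 : (2 * (m + 1)).choose (m + 1) = 2 * (2 * m + 1).choose m := by
        have h' : (2 * m + 1).choose (m + 1) = (2 * m + 1).choose m := Nat.choose_symm_half m
        rw [show 2 * (m + 1) = (2 * m + 1) + 1 by ring, Nat.choose_succ_succ, Nat.succ_eq_add_one, h']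
        ring
      rw [show 2 * (m + 1) / 2 = m + 1 by omega, e2]
      change 2 * (∑ x : Fin (2 * m + 2) → Bool, |∑ i, toSign (x i)|) + _ = _
      rw [e]; push_cast; ring
    exact ⟨this, step _ this⟩

lemma abs_total (N : ℕ) (hN : 0 < N) :
    ∑ x : Fin N → Bool, |∑ i, toSign (x i)| = 2 * N * ((N - 1).choose ((N - 1) / 2) : ℝ) := by
  obtain ⟨m, rfl | rfl⟩ : ∃ m, N = 2 * m + 1 ∨ N = 2 * m + 2 := ⟨(N - 1) / 2, by omega⟩
  · rw [(abs_odd m).1, show 2 * m + 1 - 1 = 2 * m by omega, show 2 * m / 2 = m by omega]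
    push_cast; ring
  · rw [(abs_odd m).2, show 2 * m + 2 - 1 = 2 * m + 1 by omega, show (2 * m + 1) / 2 = m by omega]
    push_cast; ring

lemma toSign_abs (b : Bool) : |toSign b| = 1 := by cases b <;> simp [toSign]

lemma upper (N : ℕ) (f : (Fin N → Bool) → Bool) :
    ∑ i : Fin N, |∑ x : Fin N → Bool, toSign (x i) * toSign (f x)|
      ≤ ∑ x : Fin N → Bool, |∑ i, toSign (x i)| := by
  have hb : ∀ i : Fin N, ∃ b : Bool, |∑ x : Fin N → Bool, toSign (x i) * toSign (f x)|
      = toSign b * ∑ x : Fin N → Bool, toSign (x i) * toSign (f x) := by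
    intro i
    rcases abs_choice (∑ x : Fin N → Bool, toSign (x i) * toSign (f x)) with h | h
    · exact ⟨true, by rw [h]; simp [toSign]⟩
    · exact ⟨false, by rw [h]; simp [toSign]⟩
  choose b hb using hb
  have inv : Function.Involutive
      (fun (x : Fin N → Bool) (i : Fin N) => (x i == b i)) := by
    intro x; ext i; change ((x i == b i) == b i) = x i; cases x i <;> cases b i <;> rfl
  calc _ = ∑ x : Fin N → Bool, (∑ i, toSign (b i) * toSign (x i)) * toSign (f x) := by
        simp only [hb, Finset.mul_sum, Finset.sum_mul, mul_assoc]
        rw [Finset.sum_comm]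
    _ ≤ ∑ x : Fin N → Bool, |∑ i, toSign (b i) * toSign (x i)| := by
        refine Finset.sum_le_sum fun x _ => (le_abs_self _).trans ?_
        rw [abs_mul, toSign_abs, mul_one]
    _ = _ := by
        rw [← Equiv.sum_comp (inv.toPerm) (fun x : Fin N → Bool => |∑ i, toSign (x i)|)]
        refine Finset.sum_congr rfl fun x _ => ?_
        congr 1
        refine Finset.sum_congr rfl fun i _ => ?_
        change _ = toSign (x i == b i)
        cases x i <;> cases b i <;> simp [toSign]

lemma lower (N : ℕ) (f : (Fin N → Bool) → Bool) (hf : IsMajority N f) :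
    ∑ x : Fin N → Bool, |∑ i, toSign (x i)|
      ≤ ∑ i : Fin N, |∑ x : Fin N → Bool, toSign (x i) * toSign (f x)| := by
  calc _ = ∑ i : Fin N, ∑ x : Fin N → Bool, toSign (x i) * toSign (f x) := by
        rw [Finset.sum_comm]
        refine Finset.sum_congr rfl fun x _ => ?_
        rw [← Finset.sum_mul]
        rcases lt_trichotomy (∑ i, toSign (x i)) 0 with h | h | h
        · rw [(hf x).2 h, abs_of_neg h]; simp [toSign]
        · rw [h]; simp
        · rw [(hf x).1 h, abs_of_pos h]; simp [toSign]
    _ ≤ _ := Finset.sum_le_sum fun i _ => le_abs_self _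

lemma Pavg_eq (N : ℕ) (f : (Fin N → Bool) → Bool) :
    Pavg N f = 1 / 2 + (1 / (2 * N)) *
      ((∑ i : Fin N, |∑ x : Fin N → Bool, toSign (x i) * toSign (f x)|) / 2 ^ N) := by
  unfold Pavg
  rw [Finset.sum_div]
  simp only [abs_div, abs_pow, Nat.abs_ofNat]

lemma value_eq (N : ℕ) (hN : 0 < N) :
    1 / 2 + ((N - 1).choose ((N - 1) / 2) : ℝ) / 2 ^ N
      = 1 / 2 + (1 / (2 * N)) * ((∑ x : Fin N → Bool, |∑ i, toSign (x i)|) / 2 ^ N) := by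
  rw [abs_total N hN]
  have : (N:ℝ) ≠ 0 := by positivity
  field_simp

/-- **optimal classical one-bit average RAC.** The maximum of `P_avg(f)` over
all encoders `f : {-1,+1}^N → {-1,+1}` equals `1/2 + 2^{-N} C(N-1, ⌊(N-1)/2⌋)`, and it is
attained by every majority function. -/
theorem classical_one_bit_rac_optimum (N : ℕ) (hN : 0 < N) :
    (∀ f : (Fin N → Bool) → Bool,
        Pavg N f ≤ 1 / 2 + ((N - 1).choose ((N - 1) / 2) : ℝ) / 2 ^ N) ∧
    (∀ f : (Fin N → Bool) → Bool, IsMajority N f →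
        Pavg N f = 1 / 2 + ((N - 1).choose ((N - 1) / 2) : ℝ) / 2 ^ N) := by
  refine ⟨fun f => ?_, fun f hf => ?_⟩
  · rw [value_eq N hN, Pavg_eq]
    have := upper N f
    gcongr
  · rw [value_eq N hN, Pavg_eq, le_antisymm (upper N f) (lower N f hf)]
end

section
/- As N → ∞, the optimal classical one-bit average RAC success probability satisfies the asymptotic expansion 1/2 + 2^{−N} · C(N−1, ⌊(N−1)/2⌋) = 1/2 + 1/√(2πN) + O(N^{−3/2}); equivalently, the function N ↦ 2^{−N} · C(N−1, ⌊(N−1)/2⌋) − 1/√(2πN) is O(N^{−3/2}). -/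
open Filter

lemma rac_W (m : ℕ) :
    Real.Wallis.W m * (((m.centralBinom : ℝ) / 4 ^ m) ^ 2 * (2 * m + 1)) = 1 := by
  have h : (m.centralBinom : ℝ) * ((m.factorial : ℝ) * m.factorial) = (2 * m).factorial := by
    have := Nat.choose_mul_factorial_mul_factorial (n := 2 * m) (k := m) (by omega)
    rw [show 2 * m - m = m by omega] at this
    rw [Nat.centralBinom, ← mul_assoc]
    exact_mod_cast this
  have h1 : (m.factorial : ℝ) ≠ 0 := by positivity
  have h2 : (m.centralBinom : ℝ) ≠ 0 := by
    have := Nat.centralBinom_pos m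
    positivity
  have h3 : (2 * (m : ℝ) + 1) ≠ 0 := by positivity
  rw [Real.Wallis.W_eq_factorial_ratio, ← h, show (2 : ℝ) ^ (4 * m) = (4 ^ m) ^ 2 by
    rw [← pow_mul, show (4 : ℝ) = 2 ^ 2 by norm_num, ← pow_mul]; congr 1; ring]
  field_simp

lemma rac_bounds (m : ℕ) :
    1 ≤ ((m.centralBinom : ℝ) / 4 ^ m) ^ 2 * (2 * m + 1) * (Real.pi / 2) ∧
    ((m.centralBinom : ℝ) / 4 ^ m) ^ 2 * (2 * m + 1) * (Real.pi / 2) * (2 * m + 1)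
      ≤ 2 * m + 2 := by
  have h := rac_W m
  have h1 := Real.Wallis.W_le m
  have h2 := Real.Wallis.le_W m
  have hm : (0 : ℝ) ≤ m := by positivity
  have hx : 0 ≤ ((m.centralBinom : ℝ) / 4 ^ m) ^ 2 * (2 * m + 1) := by positivity
  generalize ((m.centralBinom : ℝ) / 4 ^ m) ^ 2 * (2 * m + 1) = x at *
  constructor
  · nlinarith
  · rw [div_mul_eq_mul_div, div_le_iff₀ (by positivity)] at h2
    have := mul_le_mul_of_nonneg_right h2 hx
    have h4 : Real.Wallis.W m * (2 * m + 2) * x = 2 * m + 2 := by linear_combination (2*m+2) * h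
    linarith

lemma rac_key (N : ℕ) (hN : 1 ≤ N) :
    |(((N - 1).choose ((N - 1) / 2) : ℝ) / 2 ^ N) ^ 2 * (2 * Real.pi * N) - 1| ≤ 1 / (N : ℝ) := by
  rw [abs_le]
  obtain ⟨m, rfl | rfl⟩ : ∃ m, N = 2 * m + 1 ∨ N = 2 * m + 2 :=
    ⟨(N - 1) / 2, by omega⟩
  · have e : (((2 * m + 1 - 1).choose ((2 * m + 1 - 1) / 2) : ℕ) : ℝ) / 2 ^ (2 * m + 1)
        = (m.centralBinom : ℝ) / 4 ^ m / 2 := by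
      rw [show 2 * m + 1 - 1 = 2 * m by omega, show 2 * m / 2 = m by omega,
        ← Nat.centralBinom, pow_succ, pow_mul, div_div]
      norm_num
    obtain ⟨h1, h2⟩ := rac_bounds m
    rw [e]
    push_cast
    have hm : (0 : ℝ) < 2 * m + 1 := by positivity
    have : (0 : ℝ) < 1 / (2 * m + 1) := by positivity
    constructor
    · nlinarith
    · rw [le_div_iff₀ hm]
      nlinarith
  · have e : (((2 * m + 2 - 1).choose ((2 * m + 2 - 1) / 2) : ℕ) : ℝ) / 2 ^ (2 * m + 2)
        = ((m + 1).centralBinom : ℝ) / 4 ^ (m + 1) / 2 := by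
      have h : (m + 1).centralBinom = 2 * (2 * m + 1).choose m := by
        rw [Nat.centralBinom, show 2 * (m + 1) = 2 * m + 1 + 1 by ring, Nat.choose_succ_succ,
          Nat.choose_symm_half]
        ring
      rw [show 2 * m + 2 - 1 = 2 * m + 1 by omega, show (2 * m + 1) / 2 = m by omega, h,
        show 2 * m + 2 = 2 * (m + 1) by ring, pow_mul]
      push_cast
      norm_num
      ring
    obtain ⟨h1, h2⟩ := rac_bounds (m + 1)
    rw [e]
    push_cast at *
    generalize ((m + 1).centralBinom : ℝ) / 4 ^ (m + 1) = c at *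
    obtain ⟨n, hn⟩ : ∃ n : ℝ, n = 2 * m + 2 := ⟨_, rfl⟩
    have hn0 : 0 < n := by rw [hn]; positivity
    rw [show 2 * ((m : ℝ) + 1) = n by linarith] at h1 h2
    rw [← hn]
    obtain ⟨y, hy⟩ : ∃ y, y = c ^ 2 * (Real.pi / 2) := ⟨_, rfl⟩
    have g1 : 1 ≤ y * (n + 1) := by rw [hy]; linarith
    have g2 : y * (n + 1) ^ 2 ≤ n + 2 := by rw [hy]; linarith
    have g3 : (c / 2) ^ 2 * (2 * Real.pi * n) = y * n := by rw [hy]; ring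
    rw [g3]
    have hi : 0 < 1 / n := by positivity
    have hy0 : 0 ≤ y := by rw [hy]; positivity
    have g4 : y * n ≤ 1 := by
      by_contra hc
      push Not at hc
      nlinarith
    constructor
    · have : y ≤ 1 / n := by rw [le_div_iff₀ hn0]; exact g4
      linarith
    · linarith

/-- **asymptotics of the majority benchmark.** As `N → ∞`,
`2^{-N} C(N-1, ⌊(N-1)/2⌋) = 1/√(2πN) + O(N^{-3/2})`; i.e., the difference
`2^{-N} C(N-1, ⌊(N-1)/2⌋) - 1/√(2πN)` is `O(N^{-3/2})`. -/
theorem classical_one_bit_rac_asymptotics :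
    (fun N : ℕ =>
        ((N - 1).choose ((N - 1) / 2) : ℝ) / 2 ^ N - 1 / Real.sqrt (2 * Real.pi * N))
      =O[atTop] (fun N : ℕ => (N : ℝ) ^ (-(3 / 2 : ℝ))) := by
  apply Asymptotics.IsBigO.of_bound 1
  filter_upwards [eventually_ge_atTop 1] with N hN
  have hk := rac_key N hN
  have hf : 0 ≤ ((N - 1).choose ((N - 1) / 2) : ℝ) / 2 ^ N := by positivity
  generalize ((N - 1).choose ((N - 1) / 2) : ℝ) / 2 ^ N = f at *
  have hN0 : (0 : ℝ) < N := by exact_mod_cast hN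
  have hpi := Real.pi_gt_three
  have hq : Real.sqrt (2 * Real.pi * N) ^ 2 = 2 * Real.pi * N := Real.sq_sqrt (by positivity)
  have hq0 : 0 < Real.sqrt (2 * Real.pi * N) := Real.sqrt_pos.2 (by positivity)
  have hqN : Real.sqrt N ≤ Real.sqrt (2 * Real.pi * N) := Real.sqrt_le_sqrt (by nlinarith)
  have hsN : 0 < Real.sqrt N := Real.sqrt_pos.2 hN0
  rw [← hq] at hk
  generalize Real.sqrt (2 * Real.pi * N) = q at *
  have hr : (N : ℝ) ^ (-(3 / 2 : ℝ)) = 1 / N / Real.sqrt N := by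
    rw [Real.rpow_neg hN0.le, show (3 / 2 : ℝ) = 1 + 1 / 2 by norm_num, Real.rpow_add hN0,
      Real.rpow_one, ← Real.sqrt_eq_rpow]
    field_simp
  rw [one_mul, Real.norm_eq_abs, Real.norm_eq_abs, abs_of_nonneg (a := (N : ℝ) ^ _) (by positivity),
    hr]
  have e1 : f - 1 / q = (f * q - 1) / q := by field_simp
  have e2 : f ^ 2 * q ^ 2 - 1 = (f * q - 1) * (f * q + 1) := by ring
  rw [e2, abs_mul, abs_of_pos (a := f * q + 1) (by positivity)] at hk
  rw [e1, abs_div, abs_of_pos hq0]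
  have h3 : |f * q - 1| ≤ 1 / N := by
    refine le_trans ?_ hk
    have := mul_nonneg (abs_nonneg (f * q - 1)) (mul_nonneg hf hq0.le)
    linarith
  gcongr
end

section
/- Fix n ≥ 1 and a query string b = b₁b₂⋯b_n ∈ {0,1}ⁿ. Let a : {0,1}ⁿ → {0,1} assign a database bit to each leaf, and for every binary string w of length < n let A_w, e_w ∈ {0,1} be arbitrary bits. Define messages recursively: x_u := a(u) for |u| = n, and x_w := x_{w0} ⊕ A_w for |w| < n; define s_w := x_{w0} ⊕ x_{w1}, and for w = b₁⋯b_r on the query path set t_w := b_{r+1} and B_w := A_w ⊕ (s_w · t_w) ⊕ e_w. Then the decoder output β := x_ε ⊕ (⊕_{r=0}^{n−1} B_{b₁⋯b_r}) satisfies the exact identity β = a(b) ⊕ (⊕_{r=0}^{n−1} e_{b₁⋯b_r}), where ε is the empty string. In particular, the output is correct if and only if an even number of the path error bits e_{b₁⋯b_r} equal 1. -/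
/-- Messages of the nested (pyramid) protocol, indexed by the number `k` of levels between
the node and the leaves: at a leaf (`k = 0`) the message is the database bit `a w`, and at an
internal node `x_w = x_{w0} ⊕ A_w` (fuel recursion on `k`; for a node `w` of a depth-`n` tree
one takes `k = n - |w|`). -/
def nestMsg (a A : List Bool → Bool) : ℕ → List Bool → Bool
  | 0, w => a w
  | k + 1, w => xor (nestMsg a A k (w ++ [false])) (A w)

/-- The message `x_w` at node `w` of the depth-`n` tree: `x_u = a(u)` for `|u| = n` and
`x_w = x_{w0} ⊕ A_w` for `|w| < n`. -/
def nodeMsg (n : ℕ) (a A : List Bool → Bool) (w : List Bool) : Bool :=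
  nestMsg a A (n - w.length) w

/-- Alice's box input at node `w`: `s_w = x_{w0} ⊕ x_{w1}`. -/
def nodeS (n : ℕ) (a A : List Bool → Bool) (w : List Bool) : Bool :=
  xor (nodeMsg n a A (w ++ [false])) (nodeMsg n a A (w ++ [true]))

/-- The length-`r` prefix `b₁⋯b_r` of the query string `b`. -/
def queryPrefix {n : ℕ} (b : Fin n → Bool) (r : ℕ) : List Bool :=
  (List.ofFn b).take r

/-- Bob's box output at the path node `w = b₁⋯b_r`: `B_w = A_w ⊕ (s_w · t_w) ⊕ e_w`
with `t_w = b_{r+1}`. -/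
def pathB (n : ℕ) (a A e : List Bool → Bool) (b : Fin n → Bool) (r : Fin n) : Bool :=
  xor (xor (A (queryPrefix b r)) (nodeS n a A (queryPrefix b r) && b r)) (e (queryPrefix b r))

/-- The decoder output `β = x_ε ⊕ (⊕_{r=0}^{n-1} B_{b₁⋯b_r})`. -/
def decoderOutput (n : ℕ) (a A e : List Bool → Bool) (b : Fin n → Bool) : Bool :=
  xor (nodeMsg n a A []) (List.foldr xor false (List.ofFn (pathB n a A e b)))

theorem foldr_xor_telescope (n : ℕ) : ∀ (X : ℕ → Bool) (E : Fin n → Bool),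
    List.foldr xor false (List.ofFn (fun r : Fin n => xor (xor (X r) (X (r + 1))) (E r)))
      = xor (xor (X 0) (X n)) (List.foldr xor false (List.ofFn E)) := by
  induction n with
  | zero => intro X E; simp
  | succ n ih =>
    intro X E
    have h := ih (fun k => X (k + 1)) (fun r => E r.succ)
    simp only [List.ofFn_succ, List.foldr_cons, Fin.val_succ, Fin.val_zero] at h ⊢
    rw [h]
    simp only [Nat.zero_add]
    generalize List.foldr xor false (List.ofFn fun r : Fin n => E r.succ) = z
    generalize X 0 = p
    generalize X 1 = q
    generalize X (n + 1) = s
    generalize E 0 = t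
    revert p q s t z
    decide

theorem foldr_xor_even (n : ℕ) : ∀ (E : Fin n → Bool),
    List.foldr xor false (List.ofFn E) = false ↔
      Even (Finset.univ.filter (fun r : Fin n => E r = true)).card := by
  induction n with
  | zero => intro E; simp
  | succ n ih =>
    intro E
    have h := ih (fun r => E r.succ)
    rw [Fin.card_filter_univ_succ, List.ofFn_succ, List.foldr_cons]
    cases h0 : E 0
    · simpa using h
    · simp only [if_true, Nat.even_add_one]
      rw [← h]
      simp

theorem pathB_eq (n : ℕ) (a A e : List Bool → Bool) (b : Fin n → Bool) (r : Fin n) :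
    pathB n a A e b r = xor (xor (nodeMsg n a A (queryPrefix b r))
      (nodeMsg n a A (queryPrefix b (r + 1)))) (e (queryPrefix b r)) := by
  have hr := r.2
  have hs : queryPrefix b (r + 1) = queryPrefix b r ++ [b r] := by
    unfold queryPrefix
    rw [List.take_add_one]
    simp
  have hl : (queryPrefix b r).length = r := by
    simp [queryPrefix]
  have hm : nodeMsg n a A (queryPrefix b r)
      = xor (nodeMsg n a A (queryPrefix b r ++ [false])) (A (queryPrefix b r)) := by
    unfold nodeMsg
    rw [List.length_append, hl]
    have : n - (r : ℕ) = (n - (r + 1)) + 1 := by omega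
    rw [this]
    rfl
  rw [hs, hm]
  unfold pathB nodeS
  generalize A (queryPrefix b r) = p
  generalize e (queryPrefix b r) = q
  cases b r <;>
  generalize nodeMsg n a A (queryPrefix b r ++ [false]) = u <;>
  generalize nodeMsg n a A (queryPrefix b r ++ [true]) = v <;>
  revert p q u v <;> decide

/-- **global parity structure of the nested protocol.** For any depth `n ≥ 1`,
query `b ∈ {0,1}ⁿ`, database `a`, and arbitrary bits `A_w, e_w`, the decoder output satisfies
`β = a(b) ⊕ (⊕_{r=0}^{n-1} e_{b₁⋯b_r})`; in particular the output is correct iff an even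
number of the path error bits `e_{b₁⋯b_r}` equal `1`. -/
theorem nested_protocol_parity (n : ℕ) (hn : 1 ≤ n)
    (b : Fin n → Bool) (a A e : List Bool → Bool) :
    decoderOutput n a A e b
      = xor (a (List.ofFn b))
          (List.foldr xor false (List.ofFn (fun r : Fin n => e (queryPrefix b r)))) ∧
    (decoderOutput n a A e b = a (List.ofFn b) ↔
      Even (Finset.univ.filter (fun r : Fin n => e (queryPrefix b r) = true)).card) := by
  have h1 : decoderOutput n a A e b
      = xor (a (List.ofFn b))
          (List.foldr xor false (List.ofFn (fun r : Fin n => e (queryPrefix b r)))) := by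
    unfold decoderOutput
    rw [funext (pathB_eq n a A e b),
      foldr_xor_telescope n (fun k => nodeMsg n a A (queryPrefix b k))]
    have h0 : queryPrefix b 0 = [] := by simp [queryPrefix]
    have hN : queryPrefix b n = List.ofFn b := by
      unfold queryPrefix
      exact List.take_of_length_le (by simp)
    have hA : nodeMsg n a A (List.ofFn b) = a (List.ofFn b) := by
      simp [nodeMsg, nestMsg]
    simp only [h0, hN, hA]
    rw [← Bool.xor_assoc, ← Bool.xor_assoc, Bool.xor_self, Bool.false_xor]
  refine ⟨h1, ?_⟩
  rw [h1, ← foldr_xor_even]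
  generalize List.foldr xor false (List.ofFn (fun r : Fin n => e (queryPrefix b r))) = z
  generalize a (List.ofFn b) = y
  revert y z
  decide
end

section
/- Let E ∈ [0,1]. For every n ≥ 1, the nested-protocol information score satisfies the growth lower bound 2ⁿ · [1 − h((1 + Eⁿ)/2)] ≥ (2E²)ⁿ/(2 ln 2). Consequently, if E > 1/√2, then there exists n such that 2ⁿ · [1 − h((1 + Eⁿ)/2)] > 1; hence the condition E ≤ 1/√2 (the Tsirelson threshold) is necessary for the quantity 2ⁿ · [1 − h((1 + Eⁿ)/2)] to remain at most 1 for all n. -/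
lemma log_sub_log_ge {x : ℝ} (h0 : 0 ≤ x) (h1 : x < 1) :
    2 * x ≤ Real.log ((1 + x) / 2) - Real.log (1 - (1 + x) / 2) := by
  have h2 : 0 < 1 - x := by linarith
  have h := Real.le_log_one_add_of_nonneg (x := 2 * x / (1 - x)) (by positivity)
  have e1 : 2 * (2 * x / (1 - x)) / (2 * x / (1 - x) + 2) = 2 * x := by
    have : 2 * x / (1 - x) + 2 = 2 / (1 - x) := by field_simp; ring
    rw [this]; field_simp
  rw [e1] at h
  rw [← Real.log_div (by linarith) (by linarith)]
  have e2 : (1 + x) / 2 / (1 - (1 + x) / 2) = 1 + 2 * x / (1 - x) := by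
    have : 1 - (1 + x) / 2 = (1 - x) / 2 := by ring
    rw [this]; field_simp; ring
  rw [e2]; exact h

lemma binEntropy_quad {x : ℝ} (h0 : 0 ≤ x) (h1 : x ≤ 1) :
    x ^ 2 / 2 ≤ Real.log 2 - Real.binEntropy ((1 + x) / 2) := by
  have hm : MonotoneOn (fun x : ℝ => - Real.binEntropy ((1 + x) / 2) - x ^ 2 / 2)
      (Set.Icc 0 1) := by
    have hd : ∀ y ∈ Set.Ioo (0 : ℝ) 1, HasDerivAt
        (fun x : ℝ => - Real.binEntropy ((1 + x) / 2) - x ^ 2 / 2)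
        (-((Real.log (1 - (1 + y) / 2) - Real.log ((1 + y) / 2)) * (1 / 2)) - y) y := by
      intro y hy
      have a : HasDerivAt (fun x : ℝ => (1 + x) / 2) (1 / 2) y :=
        ((hasDerivAt_id y).const_add 1).div_const 2
      have b := Real.hasDerivAt_binEntropy (p := (1 + y) / 2)
        (by linarith [hy.1]) (by linarith [hy.2])
      have c : HasDerivAt (fun x : ℝ => x ^ 2 / 2) y y := by
        have := (hasDerivAt_pow 2 y).div_const 2
        have e : ((2 : ℕ) : ℝ) * y ^ (2 - 1) / 2 = y := by norm_num
        rw [e] at this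
        exact this
      exact (b.comp y a).neg.sub c
    apply monotoneOn_of_deriv_nonneg (convex_Icc 0 1)
    · exact Continuous.continuousOn (by fun_prop)
    · rw [interior_Icc]
      intro y hy
      exact (hd y hy).differentiableAt.differentiableWithinAt
    · rw [interior_Icc]
      intro y hy
      rw [(hd y hy).deriv]
      linarith [log_sub_log_ge hy.1.le hy.2]
  have := hm (Set.left_mem_Icc.2 zero_le_one) ⟨h0, h1⟩ h0
  have e : Real.binEntropy ((1 + 0) / 2) = Real.log 2 := by
    rw [← Real.binEntropy_two_inv]; norm_num
  simp only [e] at this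
  linarith

lemma binEnt_eq (p : ℝ) : binEnt p = Real.binEntropy p / Real.log 2 := by
  simp only [binEnt, Real.binEntropy, Real.logb, Real.log_inv]
  ring

lemma score_bound (E : ℝ) (hE : E ∈ Set.Icc (0 : ℝ) 1) (n : ℕ) :
    (2 * E ^ 2) ^ n / (2 * Real.log 2)
        ≤ 2 ^ n * (1 - binEnt ((1 + E ^ n) / 2)) := by
  have hl : 0 < Real.log 2 := Real.log_pos (by norm_num)
  have h := binEntropy_quad (pow_nonneg hE.1 n) (pow_le_one₀ hE.1 hE.2)
  have e1 : (2 * E ^ 2) ^ n / (2 * Real.log 2)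
      = 2 ^ n * ((E ^ n) ^ 2 / 2 / Real.log 2) := by
    rw [mul_pow, ← pow_mul, ← pow_mul, mul_comm 2 n]; field_simp
  have e2 : 1 - binEnt ((1 + E ^ n) / 2)
      = (Real.log 2 - Real.binEntropy ((1 + E ^ n) / 2)) / Real.log 2 := by
    rw [binEnt_eq]; field_simp
  rw [e1, e2]
  gcongr

lemma score_exceeds (E : ℝ) (hE : E ∈ Set.Icc (0 : ℝ) 1) (h : 1 / Real.sqrt 2 < E) :
    ∃ n : ℕ, 1 < 2 ^ n * (1 - binEnt ((1 + E ^ n) / 2)) := by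
  have hl : 0 < Real.log 2 := Real.log_pos (by norm_num)
  have h2 : 1 < 2 * E ^ 2 := by
    have := pow_lt_pow_left₀ h (by positivity) two_ne_zero
    rw [div_pow, Real.sq_sqrt (by norm_num)] at this
    linarith
  obtain ⟨n, hn⟩ := pow_unbounded_of_one_lt (2 * Real.log 2) h2
  refine ⟨n, lt_of_lt_of_le ?_ (score_bound E hE n)⟩
  rwa [one_lt_div (by positivity)]

/-- **IC-induced Tsirelson threshold.** For `E ∈ [0,1]`: the nested-protocol
information score obeys the growth bound
`2ⁿ [1 - h((1+Eⁿ)/2)] ≥ (2E²)ⁿ/(2 ln 2)` for every `n ≥ 1`; if `E > 1/√2` then some depth `n`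
makes the score exceed `1`; hence `E ≤ 1/√2` is necessary for the score to stay `≤ 1` at all
depths. -/
theorem ic_induced_tsirelson_bound (E : ℝ) (hE : E ∈ Set.Icc (0 : ℝ) 1) :
    (∀ n : ℕ, 1 ≤ n →
      (2 * E ^ 2) ^ n / (2 * Real.log 2)
        ≤ 2 ^ n * (1 - binEnt ((1 + E ^ n) / 2))) ∧
    (1 / Real.sqrt 2 < E →
      ∃ n : ℕ, 1 < 2 ^ n * (1 - binEnt ((1 + E ^ n) / 2))) ∧
    ((∀ n : ℕ, 2 ^ n * (1 - binEnt ((1 + E ^ n) / 2)) ≤ 1) → E ≤ 1 / Real.sqrt 2) := by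
  refine ⟨fun n _ => score_bound E hE n, score_exceeds E hE, fun h => ?_⟩
  by_contra hc
  obtain ⟨n, hn⟩ := score_exceeds E hE (not_le.1 hc)
  exact absurd (h n) (not_le.2 hn)
end

section
/- Let E₀, E₁ ∈ [0,1]. For every n ≥ 1, the asymmetric nested information score satisfies Σ_{b ∈ {0,1}ⁿ} [1 − h((1 + Π_{ℓ=1}ⁿ E_{b_ℓ})/2)] ≥ (E₀² + E₁²)ⁿ/(2 ln 2). In particular, if E₀² + E₁² > 1, then there exists n such that Σ_{b ∈ {0,1}ⁿ} [1 − h((1 + Π_{ℓ=1}ⁿ E_{b_ℓ})/2)] > 1, i.e., the one-bit Neural-IC bound is violated at sufficiently large depth. -/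
lemma key_entropy (x : ℝ) (hx : x ∈ Set.Icc (0 : ℝ) 1) :
    x ^ 2 / 2 ≤ Real.log 2 - Real.binEntropy ((1 + x) / 2) := by
  have hder : ∀ y ∈ Set.Ioo (0 : ℝ) 1,
      HasDerivAt (fun y : ℝ => Real.log 2 - Real.binEntropy ((1 + y) / 2) - y ^ 2 / 2)
        ((Real.log (1 + y) - Real.log (1 - y)) / 2 - y) y := by
    rintro y ⟨h0, h1⟩
    have hb := Real.hasDerivAt_binEntropy (p := (1 + y) / 2) (by linarith) (by linarith)
    have hi : HasDerivAt (fun y : ℝ => (1 + y) / 2) (1 / 2) y :=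
      ((hasDerivAt_id y).const_add 1).div_const 2
    have hc := hb.comp y hi
    have hq : HasDerivAt (fun y : ℝ => y ^ 2 / 2) y y := by
      have := (hasDerivAt_pow 2 y).div_const 2
      exact this.congr_deriv (by norm_num)
    have h := (hc.const_sub (Real.log 2)).sub hq
    refine HasDerivAt.congr_deriv h ?_
    have e : 1 - (1 + y) / 2 = (1 - y) / 2 := by ring
    rw [e, Real.log_div (by linarith) (by norm_num), Real.log_div (by linarith) (by norm_num)]
    ring
  have hmono : MonotoneOn
      (fun y : ℝ => Real.log 2 - Real.binEntropy ((1 + y) / 2) - y ^ 2 / 2)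
      (Set.Icc (0 : ℝ) 1) := by
    apply monotoneOn_of_deriv_nonneg (convex_Icc 0 1)
    · have := Real.binEntropy_continuous
      fun_prop
    · rw [interior_Icc]
      intro y hy
      exact (hder y hy).differentiableAt.differentiableWithinAt
    · rw [interior_Icc]
      intro y hy
      rw [(hder y hy).deriv]
      have hs := Real.hasSum_log_sub_log_of_abs_lt_one (x := y)
        (by rw [abs_of_pos hy.1]; exact hy.2)
      have := le_hasSum hs 0 (fun k _ => by have := hy.1; positivity)
      norm_num at this
      linarith
  have h := hmono (Set.left_mem_Icc.2 zero_le_one) hx hx.1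
  have e : ((1 : ℝ) + 0) / 2 = 2⁻¹ := by norm_num
  simp only [e, Real.binEntropy_two_inv] at h
  linarith

lemma key_bits (x : ℝ) (hx : x ∈ Set.Icc (0 : ℝ) 1) :
    x ^ 2 / (2 * Real.log 2) ≤ 1 - binEnt ((1 + x) / 2) := by
  have hl : 0 < Real.log 2 := Real.log_pos (by norm_num)
  have h := div_le_div_of_nonneg_right (key_entropy x hx) hl.le
  rw [binEnt_eq]
  rw [sub_div, div_self hl.ne', div_div] at h
  exact h

lemma score_bound_s18 (E0 E1 : ℝ)
    (hE0 : E0 ∈ Set.Icc (0 : ℝ) 1) (hE1 : E1 ∈ Set.Icc (0 : ℝ) 1) (n : ℕ) :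
    (E0 ^ 2 + E1 ^ 2) ^ n / (2 * Real.log 2)
        ≤ ∑ b : Fin n → Bool,
            (1 - binEnt ((1 + ∏ ℓ : Fin n, (if b ℓ then E1 else E0)) / 2)) := by
  have hsum : (E0 ^ 2 + E1 ^ 2) ^ n
      = ∑ b : Fin n → Bool, (∏ ℓ : Fin n, (if b ℓ then E1 else E0)) ^ 2 := by
    have := Finset.prod_univ_sum (fun _ : Fin n => (Finset.univ : Finset Bool))
      (fun _ c => (if c then E1 else E0) ^ 2)
    simp only [Fintype.piFinset_univ, Finset.prod_pow] at this
    rw [← this]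
    simp [add_comm]
  rw [hsum, Finset.sum_div]
  refine Finset.sum_le_sum fun b _ => key_bits _ ⟨?_, ?_⟩
  · exact Finset.prod_nonneg fun i _ => by split_ifs; exacts [hE1.1, hE0.1]
  · exact Finset.prod_le_one (fun i _ => by split_ifs; exacts [hE1.1, hE0.1])
      (fun i _ => by split_ifs; exacts [hE1.2, hE0.2])

/-- **asymmetric bias multiplication and IC violation.** For branch biases
`E₀, E₁ ∈ [0,1]`, the asymmetric nested information score obeys
`Σ_{b ∈ {0,1}ⁿ} [1 - h((1 + Π_ℓ E_{b_ℓ})/2)] ≥ (E₀² + E₁²)ⁿ/(2 ln 2)` for every `n ≥ 1`;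
in particular, if `E₀² + E₁² > 1`, then some depth `n` makes the score exceed `1`. -/
theorem asymmetric_bias_ic_violation (E0 E1 : ℝ)
    (hE0 : E0 ∈ Set.Icc (0 : ℝ) 1) (hE1 : E1 ∈ Set.Icc (0 : ℝ) 1) :
    (∀ n : ℕ, 1 ≤ n →
      (E0 ^ 2 + E1 ^ 2) ^ n / (2 * Real.log 2)
        ≤ ∑ b : Fin n → Bool,
            (1 - binEnt ((1 + ∏ ℓ : Fin n, (if b ℓ then E1 else E0)) / 2))) ∧
    (1 < E0 ^ 2 + E1 ^ 2 →
      ∃ n : ℕ, 1 < ∑ b : Fin n → Bool,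
          (1 - binEnt ((1 + ∏ ℓ : Fin n, (if b ℓ then E1 else E0)) / 2))) := by
  refine ⟨fun n _ => score_bound_s18 E0 E1 hE0 hE1 n, fun h => ?_⟩
  obtain ⟨n, hn⟩ := pow_unbounded_of_one_lt (2 * Real.log 2) h
  have hl : 0 < Real.log 2 := Real.log_pos (by norm_num)
  refine ⟨n, lt_of_lt_of_le ?_ (score_bound_s18 E0 E1 hE0 hE1 n)⟩
  rw [one_lt_div (by positivity)]
  exact hn
end
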